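/- arXiv:2201.03483 — 2 statements merged into one kernel-verified Lean document; each statement's English description precedes it below -/
import Mathlib

section
/- Let μ, ν ∈ P(ℝ)^d be d-tuples of Borel probability measures on ℝ with m_μ = m_ν =: P, and let c : ℝ×ℝ → [0,∞) be continuous and submodular, i.e. c(x,y) + c(x',y') ≤ c(x,y') + c(x',y) whenever x ≤ x' and y ≤ y'. Then I_c(μ,ν) = ∫_{ℝ₊^d} ∫₀¹ c(F_z⁻¹(t), G_z⁻¹(t)) dt P(dz), where F_z⁻¹(t) := inf{x ∈ ℝ : μ_z((−∞,x]) ≥ t} and G_z⁻¹(t) := inf{y ∈ ℝ : ν_z((−∞,y]) ≥ t} are the quantile functions of μ_z and ν_z. -/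
open MeasureTheory ProbabilityTheory ENNReal
open scoped NNReal

noncomputable section

/-- Average probability measure of a `d`-tuple of probability measures. -/
def avgProb {X : Type*} [MeasurableSpace X] {d : ℕ} (μ : Fin d → Measure X) : Measure X :=
  (d : ℝ≥0∞)⁻¹ • ∑ j, μ j

/-- Vector of Radon–Nikodym derivatives of the tuple with respect to the average. -/
def densityVec {X : Type*} [MeasurableSpace X] {d : ℕ} (μ : Fin d → Measure X) (x : X) :
    Fin d → ℝ :=
  fun j => ((μ j).rnDeriv (avgProb μ) x).toReal

/-- The law of the density vector under the average measure. -/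
def mMeasure {X : Type*} [MeasurableSpace X] {d : ℕ} (μ : Fin d → Measure X) :
    Measure (Fin d → ℝ) :=
  (avgProb μ).map (densityVec μ)

/-- `μz` is a disintegration of `μ̄` with respect to the density vector map `μ'`, over the
mixing measure `P = m_μ`. -/
def IsDisintegration {X : Type*} [MeasurableSpace X] {d : ℕ} (μ : Fin d → Measure X)
    (P : Measure (Fin d → ℝ)) (μz : (Fin d → ℝ) → Measure X) : Prop :=
  (∀ A : Set X, MeasurableSet A → Measurable fun z => μz z A) ∧
    (∀ᵐ z ∂P, IsProbabilityMeasure (μz z)) ∧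
    (∀ᵐ z ∂P, μz z {x | densityVec μ x = z}ᶜ = 0) ∧
    (∀ A : Set X, MeasurableSet A → avgProb μ A = ∫⁻ z, μz z A ∂P)

/-- Infimum cost over simultaneous transport kernels from `μ` to `ν`, the reference
measure being `μ̄` (`+∞` if no transport exists). -/
def sotInfCost {d : ℕ} (μ : Fin d → Measure ℝ) (ν : Fin d → Measure ℝ)
    (c : ℝ × ℝ → ℝ≥0∞) : ℝ≥0∞ :=
  sInf {r | ∃ κ : Kernel ℝ ℝ, IsMarkovKernel κ ∧
    (∀ j, ∀ B : Set ℝ, MeasurableSet B → ν j B ≤ ∫⁻ x, κ x B ∂(μ j)) ∧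
    r = ∫⁻ x, ∫⁻ y, c (x, y) ∂(κ x) ∂(avgProb μ)}

/-- The (left-continuous) quantile function of a measure on `ℝ`. -/
def quantile (α : Measure ℝ) (t : ℝ) : ℝ :=
  sInf {x : ℝ | ENNReal.ofReal t ≤ α (Set.Iic x)}

theorem sum_range_sum_range_mixed_difference {R : Type*} [CommRing R] (c : ℕ → ℕ → R) (i j : ℕ) :
    ∑ k ∈ Finset.range i, ∑ l ∈ Finset.range j,
        (c (k + 1) (l + 1) - c (k + 1) l - (c k (l + 1) - c k l))
      = c i j - c i 0 - (c 0 j - c 0 0) := by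
  have h : ∀ k, ∑ l ∈ Finset.range j, (c (k + 1) (l + 1) - c (k + 1) l - (c k (l + 1) - c k l))
      = (c (k + 1) j - c (k + 1) 0) - (c k j - c k 0) := fun k => by
    rw [Finset.sum_sub_distrib, Finset.sum_range_sub (fun l => c (k + 1) l),
      Finset.sum_range_sub (fun l => c k l)]
  simp_rw [h]
  rw [Finset.sum_range_sub (fun k => c k j - c k 0)]

theorem sum_range_ite_lt {R : Type*} [AddCommMonoid R] {i K : ℕ} (hi : i ≤ K) (u : ℕ → R) :
    ∑ k ∈ Finset.range K, (if k < i then u k else 0) = ∑ k ∈ Finset.range i, u k := by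
  rw [← Finset.sum_filter]
  congr 1
  ext k
  simp only [Finset.mem_filter, Finset.mem_range]
  omega

/-- Summation by parts for a function of two bounded natural-number-valued variables. -/
theorem integral_comp_nat_nat {Ω : Type*} [MeasurableSpace Ω] {π : Measure Ω} [IsFiniteMeasure π]
    {f g : Ω → ℕ} (hf : Measurable f) (hg : Measurable g) {K : ℕ} (hfK : ∀ ω, f ω ≤ K)
    (hgK : ∀ ω, g ω ≤ K) (c : ℕ → ℕ → ℝ) :
    ∫ ω, c (f ω) (g ω) ∂π = c 0 0 * π.real Set.univ
      + ∑ k ∈ Finset.range K, (c (k + 1) 0 - c k 0) * π.real {ω | k < f ω}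
      + ∑ l ∈ Finset.range K, (c 0 (l + 1) - c 0 l) * π.real {ω | l < g ω}
      + ∑ k ∈ Finset.range K, ∑ l ∈ Finset.range K,
          (c (k + 1) (l + 1) - c (k + 1) l - (c k (l + 1) - c k l))
            * π.real {ω | k < f ω ∧ l < g ω} := by
  have hF : ∀ k, MeasurableSet {ω | k < f ω} := fun k => hf measurableSet_Ioi
  have hG : ∀ k, MeasurableSet {ω | k < g ω} := fun k => hg measurableSet_Ioi
  have hFG : ∀ k l, MeasurableSet {ω | k < f ω ∧ l < g ω} := fun k l => (hF k).inter (hG l)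
  have hpt : ∀ ω, c (f ω) (g ω) = c 0 0
      + ∑ k ∈ Finset.range K, {ω | k < f ω}.indicator (fun _ => c (k + 1) 0 - c k 0) ω
      + ∑ l ∈ Finset.range K, {ω | l < g ω}.indicator (fun _ => c 0 (l + 1) - c 0 l) ω
      + ∑ k ∈ Finset.range K, ∑ l ∈ Finset.range K, {ω | k < f ω ∧ l < g ω}.indicator
          (fun _ => c (k + 1) (l + 1) - c (k + 1) l - (c k (l + 1) - c k l)) ω := by
    intro ω
    simp only [Set.indicator_apply, Set.mem_ofPred_eq]
    have h1 : ∀ k l (u : ℝ), (if k < f ω ∧ l < g ω then u else 0)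
        = if k < f ω then (if l < g ω then u else 0) else 0 := fun k l u => by
      split_ifs <;> simp_all
    simp_rw [h1]
    have h2 : ∀ (k : ℕ) (u : ℕ → ℝ), ∑ l ∈ Finset.range K,
        (if k < f ω then (if l < g ω then u l else 0) else 0)
        = if k < f ω then ∑ l ∈ Finset.range (g ω), u l else 0 := fun k u => by
      split_ifs
      · exact sum_range_ite_lt (hgK ω) u
      · simp
    simp_rw [h2]
    rw [sum_range_ite_lt (hfK ω), sum_range_ite_lt (hfK ω), sum_range_ite_lt (hgK ω),
      sum_range_sum_range_mixed_difference, Finset.sum_range_sub (fun k => c k 0),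
      Finset.sum_range_sub (fun k => c 0 k)]
    ring
  have hint : ∀ (s : Set Ω) (u : ℝ), MeasurableSet s →
      Integrable (s.indicator (fun _ => u)) π := fun s u hs => (integrable_const u).indicator hs
  have hval : ∀ (s : Set Ω) (u : ℝ), MeasurableSet s →
      ∫ ω, s.indicator (fun _ => u) ω ∂π = u * π.real s := fun s u hs => by
    rw [integral_indicator_const u hs, smul_eq_mul, mul_comm]
  have i1 : Integrable (fun ω => ∑ k ∈ Finset.range K,
      {ω | k < f ω}.indicator (fun _ => c (k + 1) 0 - c k 0) ω) π :=
    integrable_finsetSum _ fun k _ => hint _ _ (hF k)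
  have i2 : Integrable (fun ω => ∑ l ∈ Finset.range K,
      {ω | l < g ω}.indicator (fun _ => c 0 (l + 1) - c 0 l) ω) π :=
    integrable_finsetSum _ fun k _ => hint _ _ (hG k)
  have i3 : ∀ k, Integrable (fun ω => ∑ l ∈ Finset.range K, {ω | k < f ω ∧ l < g ω}.indicator
      (fun _ => c (k + 1) (l + 1) - c (k + 1) l - (c k (l + 1) - c k l)) ω) π := fun k =>
    integrable_finsetSum _ fun l _ => hint _ _ (hFG k l)
  have i0 : Integrable (fun _ : Ω => c 0 0) π := integrable_const _
  have i4 := integrable_finsetSum (Finset.range K) fun k _ => i3 k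
  simp_rw [hpt]
  rw [integral_add (by exact (i0.add i1).add i2) i4, integral_add (by exact i0.add i1) i2,
    integral_add i0 i1,
    integral_finsetSum _ fun k _ => hint _ _ (hF k),
    integral_finsetSum _ fun k _ => hint _ _ (hG k),
    integral_finsetSum _ fun k _ => i3 k]
  simp_rw [integral_finsetSum (Finset.range K) fun l _ => hint _ _ (hFG _ l)]
  simp_rw [hval _ _ (hF _), hval _ _ (hG _), hval _ _ (hFG _ _)]
  simp [mul_comm]

/-- Submodular functions decrease in the concordance order: discrete case. -/
theorem integral_comp_nat_nat_le_of_concordance {Ω Ω' : Type*} [MeasurableSpace Ω]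
    [MeasurableSpace Ω'] {π : Measure Ω} {ρ : Measure Ω'} [IsProbabilityMeasure π]
    [IsProbabilityMeasure ρ] {f g : Ω → ℕ} {f' g' : Ω' → ℕ}
    (hf : Measurable f) (hg : Measurable g) (hf' : Measurable f') (hg' : Measurable g') {K : ℕ}
    (hfK : ∀ ω, f ω ≤ K) (hgK : ∀ ω, g ω ≤ K) (hfK' : ∀ ω, f' ω ≤ K) (hgK' : ∀ ω, g' ω ≤ K)
    (hff : ∀ k, ρ {ω | k < f' ω} = π {ω | k < f ω})
    (hgg : ∀ k, ρ {ω | k < g' ω} = π {ω | k < g ω})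
    (hfg : ∀ k l, π {ω | k < f ω ∧ l < g ω} ≤ ρ {ω | k < f' ω ∧ l < g' ω})
    (c : ℕ → ℕ → ℝ) (hsub : ∀ k l, c k l + c (k + 1) (l + 1) ≤ c k (l + 1) + c (k + 1) l) :
    ∫ ω, c (f' ω) (g' ω) ∂ρ ≤ ∫ ω, c (f ω) (g ω) ∂π := by
  rw [integral_comp_nat_nat hf hg hfK hgK, integral_comp_nat_nat hf' hg' hfK' hgK']
  simp_rw [Measure.real, hff, hgg, measure_univ]
  refine (add_le_add_iff_left _).2 (Finset.sum_le_sum fun k _ => Finset.sum_le_sum fun l _ =>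
    mul_le_mul_of_nonpos_left ?_ ?_)
  · exact ENNReal.toReal_mono (measure_ne_top _ _) (hfg k l)
  · linarith [hsub k l]

theorem tendsto_neg_add_natCeil_div {N z : ℝ} (hz : -N ≤ z) :
    Filter.Tendsto (fun n : ℕ => -N + (⌈(z + N) * (n + 1)⌉₊ : ℝ) / (n + 1)) Filter.atTop
      (nhds z) := by
  have h2 : Filter.Tendsto (fun n : ℕ => z + 1 / ((n : ℝ) + 1)) Filter.atTop (nhds z) := by
    simpa using tendsto_const_nhds.add (tendsto_one_div_add_atTop_nhds_zero_nat (𝕜 := ℝ))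
  refine tendsto_of_tendsto_of_tendsto_of_le_of_le tendsto_const_nhds h2 (fun n => ?_) fun n => ?_
  · have hn : (0 : ℝ) < n + 1 := by positivity
    have := (le_div_iff₀ hn).2 (Nat.le_ceil ((z + N) * ((n : ℝ) + 1)))
    simp only
    linarith
  · have hn : (0 : ℝ) < n + 1 := by positivity
    have h0 : 0 ≤ (z + N) * ((n : ℝ) + 1) := mul_nonneg (by linarith) hn.le
    have := (div_le_iff₀ hn).2 ((Nat.ceil_lt_add_one h0).le.trans_eq
      (show _ = ((z + N) + 1 / ((n : ℝ) + 1)) * (n + 1) by field_simp))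
    simp only
    linarith

theorem integrable_continuous_comp_of_mem_compact {Ω E : Type*} [MeasurableSpace Ω]
    [TopologicalSpace E] [MeasurableSpace E] [OpensMeasurableSpace E] {τ : Measure Ω}
    [IsFiniteMeasure τ] {S : Set E} (hS : IsCompact S) {c : E → ℝ≥0} (hc : Continuous c)
    {W : Ω → E} (hW : Measurable W) (hWS : ∀ ω, W ω ∈ S) :
    Integrable (fun ω => (c (W ω) : ℝ)) τ := by
  obtain ⟨M, hM⟩ := hS.exists_bound_of_continuousOn
    (NNReal.continuous_coe.comp hc).continuousOn
  exact Integrable.of_bound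
    ((NNReal.continuous_coe.comp hc).measurable.comp hW).aestronglyMeasurable M
    (Filter.Eventually.of_forall fun ω => hM _ (hWS ω))

theorem tendsto_integral_continuous_comp_of_mem_compact {Ω E : Type*} [MeasurableSpace Ω]
    [TopologicalSpace E] [MeasurableSpace E] [OpensMeasurableSpace E] {τ : Measure Ω}
    [IsFiniteMeasure τ] {S : Set E} (hS : IsCompact S) {c : E → ℝ≥0} (hc : Continuous c)
    {W : ℕ → Ω → E} {V : Ω → E} (hW : ∀ n, Measurable (W n)) (hWS : ∀ n ω, W n ω ∈ S)
    (hWV : ∀ ω, Filter.Tendsto (fun n => W n ω) Filter.atTop (nhds (V ω))) :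
    Filter.Tendsto (fun n => ∫ ω, (c (W n ω) : ℝ) ∂τ) Filter.atTop
      (nhds (∫ ω, (c (V ω) : ℝ) ∂τ)) := by
  obtain ⟨M, hM⟩ := hS.exists_bound_of_continuousOn
    (NNReal.continuous_coe.comp hc).continuousOn
  have hcc := NNReal.continuous_coe.comp hc
  exact tendsto_integral_of_dominated_convergence (fun _ => M)
    (fun n => (hcc.measurable.comp (hW n)).aestronglyMeasurable) (integrable_const _)
    (fun n => Filter.Eventually.of_forall fun ω => hM _ (hWS n ω))
    (Filter.Eventually.of_forall fun ω => (hcc.tendsto _).comp (hWV ω))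

/-- Submodular functions decrease in the concordance order: bounded continuous case. -/
theorem lintegral_submodular_le_of_concordance_of_bounded {Ω Ω' : Type*} [MeasurableSpace Ω]
    [MeasurableSpace Ω'] {π : Measure Ω} {ρ : Measure Ω'} [IsProbabilityMeasure π]
    [IsProbabilityMeasure ρ] {X Y : Ω → ℝ} {X' Y' : Ω' → ℝ}
    (hX : Measurable X) (hY : Measurable Y) (hX' : Measurable X') (hY' : Measurable Y') {N : ℝ}
    (hXN : ∀ ω, |X ω| ≤ N) (hYN : ∀ ω, |Y ω| ≤ N) (hXN' : ∀ ω, |X' ω| ≤ N)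
    (hYN' : ∀ ω, |Y' ω| ≤ N)
    (hXX : ∀ a, ρ {ω | a < X' ω} = π {ω | a < X ω})
    (hYY : ∀ a, ρ {ω | a < Y' ω} = π {ω | a < Y ω})
    (hXY : ∀ a b, π {ω | a < X ω ∧ b < Y ω} ≤ ρ {ω | a < X' ω ∧ b < Y' ω})
    {c : ℝ × ℝ → ℝ≥0} (hc : Continuous c)
    (hsub : ∀ x x' y y' : ℝ, x ≤ x' → y ≤ y' →
      c (x, y) + c (x', y') ≤ c (x, y') + c (x', y)) :
    ∫⁻ ω, (c (X' ω, Y' ω) : ℝ≥0∞) ∂ρ ≤ ∫⁻ ω, (c (X ω, Y ω) : ℝ≥0∞) ∂π := by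
  have hK : IsCompact (Set.Icc (-N) (N + 1) ×ˢ Set.Icc (-N) (N + 1)) :=
    isCompact_Icc.prod isCompact_Icc
  set f : ℕ → ℝ → ℕ := fun n z => ⌈(z + N) * (n + 1)⌉₊ with hf
  set e : ℕ → ℕ → ℝ := fun n i => -N + (i : ℝ) / (n + 1) with he
  have hfm : ∀ n, Measurable (f n) := fun n =>
    Nat.measurable_ceil.comp ((measurable_id.add_const N).mul_const _)
  have hfe : ∀ n k z, k < f n z ↔ e n k < z := fun n k z => by
    have hn : (0 : ℝ) < n + 1 := by positivity
    rw [hf, he]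
    simp only
    rw [Nat.lt_ceil, ← div_lt_iff₀ hn]
    constructor <;> intro h <;> linarith
  have hfK : ∀ n z, |z| ≤ N → f n z ≤ ⌈(N + N) * ((n : ℝ) + 1)⌉₊ := fun n z hz => by
    apply Nat.ceil_mono
    gcongr
    exact (abs_le.1 hz).2
  have hmem : ∀ n z, |z| ≤ N → e n (f n z) ∈ Set.Icc (-N) (N + 1) := fun n z hz => by
    have hn : (1 : ℝ) ≤ n + 1 := by simp
    have hn' : (0 : ℝ) < n + 1 := by positivity
    have hz' := abs_le.1 hz
    have h0 : 0 ≤ (z + N) * ((n : ℝ) + 1) := mul_nonneg (by linarith) hn'.le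
    refine ⟨?_, ?_⟩
    · have : (0 : ℝ) ≤ (f n z : ℝ) / (n + 1) := by positivity
      simp only [he]
      linarith
    · have : (f n z : ℝ) / (n + 1) ≤ z + N + 1 := by
        rw [div_le_iff₀ hn']
        have := (Nat.ceil_lt_add_one h0).le
        simp only [hf]
        linarith
      simp only [he]
      linarith
  have hlim : ∀ z, |z| ≤ N → Filter.Tendsto (fun n => e n (f n z)) Filter.atTop (nhds z) :=
    fun z hz => tendsto_neg_add_natCeil_div (abs_le.1 hz).1
  have hmem' : ∀ z, |z| ≤ N → z ∈ Set.Icc (-N) (N + 1) := fun z hz =>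
    ⟨(abs_le.1 hz).1, by linarith [(abs_le.1 hz).2]⟩
  have hem : ∀ n, Measurable fun z => e n (f n z) := fun n =>
    (measurable_from_nat (f := e n)).comp (hfm n)
  rw [lintegral_coe_eq_integral _ (integrable_continuous_comp_of_mem_compact (τ := ρ) hK hc
      (hX'.prodMk hY') fun ω => ⟨hmem' _ (hXN' ω), hmem' _ (hYN' ω)⟩),
    lintegral_coe_eq_integral _ (integrable_continuous_comp_of_mem_compact (τ := π) hK hc
      (hX.prodMk hY) fun ω => ⟨hmem' _ (hXN ω), hmem' _ (hYN ω)⟩)]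
  refine ENNReal.ofReal_le_ofReal (le_of_tendsto_of_tendsto'
    (tendsto_integral_continuous_comp_of_mem_compact (τ := ρ) hK hc
      (fun n => ((hem n).comp hX').prodMk ((hem n).comp hY'))
      (fun n ω => ⟨hmem n _ (hXN' ω), hmem n _ (hYN' ω)⟩)
      fun ω => (hlim _ (hXN' ω)).prodMk_nhds (hlim _ (hYN' ω)))
    (tendsto_integral_continuous_comp_of_mem_compact (τ := π) hK hc
      (fun n => ((hem n).comp hX).prodMk ((hem n).comp hY))
      (fun n ω => ⟨hmem n _ (hXN ω), hmem n _ (hYN ω)⟩)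
      fun ω => (hlim _ (hXN ω)).prodMk_nhds (hlim _ (hYN ω))) fun n => ?_)
  refine integral_comp_nat_nat_le_of_concordance ((hfm n).comp hX) ((hfm n).comp hY)
    ((hfm n).comp hX') ((hfm n).comp hY') (fun ω => hfK n _ (hXN ω)) (fun ω => hfK n _ (hYN ω))
    (fun ω => hfK n _ (hXN' ω)) (fun ω => hfK n _ (hYN' ω)) (fun k => ?_) (fun k => ?_)
    (fun k l => ?_) (fun i j => (c (e n i, e n j) : ℝ)) fun k l => ?_
  · simpa only [Function.comp_apply, hfe] using hXX (e n k)
  · simpa only [Function.comp_apply, hfe] using hYY (e n k)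
  · simpa only [Function.comp_apply, hfe] using hXY (e n k) (e n l)
  · have hmono : ∀ i : ℕ, e n i ≤ e n (i + 1) := fun i => by
      simp only [he]
      gcongr
      simp
    exact_mod_cast hsub _ _ _ _ (hmono k) (hmono l)

theorem ofReal_le_measure_Iic_iff (α : Measure ℝ) [IsProbabilityMeasure α] (t x : ℝ) :
    ENNReal.ofReal t ≤ α (Set.Iic x) ↔ t ≤ cdf α x := by
  rw [← ofReal_cdf, ENNReal.ofReal_le_ofReal_iff (cdf_nonneg _ _)]

theorem quantile_le_iff (α : Measure ℝ) [IsProbabilityMeasure α] {t : ℝ}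
    (ht : t ∈ Set.Ioo (0 : ℝ) 1) (x : ℝ) : quantile α t ≤ x ↔ t ≤ cdf α x := by
  simp only [quantile, ofReal_le_measure_Iic_iff]
  have hne : {x : ℝ | t ≤ cdf α x}.Nonempty :=
    ((tendsto_cdf_atTop α).eventually (eventually_ge_nhds ht.2)).exists
  obtain ⟨b, hb⟩ := ((tendsto_cdf_atBot α).eventually (eventually_lt_nhds ht.1)).exists
  have hbdd : BddBelow {x : ℝ | t ≤ cdf α x} :=
    ⟨b, fun y hy => le_of_not_gt fun hlt => (hy.trans (monotone_cdf α hlt.le)).not_gt hb⟩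
  refine ⟨fun h => ?_, fun h => csInf_le hbdd h⟩
  refine le_trans ?_ (monotone_cdf α h)
  have hr := ((cdf α).right_continuous (sInf {x : ℝ | t ≤ cdf α x})).mono Set.Ioi_subset_Ici_self
  refine ge_of_tendsto hr ?_
  filter_upwards [self_mem_nhdsWithin] with y hy
  obtain ⟨z, hz, hzy⟩ := exists_lt_of_csInf_lt hne hy
  exact le_trans hz (monotone_cdf α hzy.le)

theorem lt_quantile_iff (α : Measure ℝ) [IsProbabilityMeasure α] {t : ℝ}
    (ht : t ∈ Set.Ioo (0 : ℝ) 1) (x : ℝ) : x < quantile α t ↔ cdf α x < t := by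
  rw [← not_le, quantile_le_iff α ht, not_le]

/-- The quantile function of each member of a kernel is jointly measurable. -/
theorem measurable_indicator_quantile {Z : Type*} [MeasurableSpace Z] (κ : Kernel Z ℝ)
    [IsMarkovKernel κ] :
    Measurable fun p : Z × ℝ => (Set.Ioo (0 : ℝ) 1).indicator (quantile (κ p.1)) p.2 := by
  have h01 : MeasurableSet {p : Z × ℝ | p.2 ∈ Set.Ioo (0 : ℝ) 1} :=
    measurable_snd measurableSet_Ioo
  refine measurable_of_Iic fun x => ?_
  have hset : (fun p : Z × ℝ => (Set.Ioo (0 : ℝ) 1).indicator (quantile (κ p.1)) p.2) ⁻¹' Set.Iic x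
      = ({p : Z × ℝ | p.2 ∈ Set.Ioo (0 : ℝ) 1} ∩
          {p | ENNReal.ofReal p.2 ≤ κ p.1 (Set.Iic x)})
        ∪ ({p : Z × ℝ | p.2 ∈ Set.Ioo (0 : ℝ) 1}ᶜ ∩ {_p | (0 : ℝ) ≤ x}) := by
    ext p
    by_cases hp : p.2 ∈ Set.Ioo (0 : ℝ) 1
    · simp only [Set.mem_preimage, Set.indicator_of_mem hp, Set.mem_Iic, quantile_le_iff _ hp,
        ofReal_le_measure_Iic_iff, Set.mem_union, Set.mem_inter_iff, Set.mem_compl_iff,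
        Set.mem_ofPred_eq, hp, true_and, not_true, false_and, or_false]
    · simp only [Set.mem_preimage, Set.indicator_of_notMem hp, Set.mem_Iic, Set.mem_union,
        Set.mem_inter_iff, Set.mem_compl_iff, Set.mem_ofPred_eq, hp, false_and, not_false_eq_true,
        true_and, false_or]
  rw [hset]
  refine (h01.inter (measurableSet_le ?_ ?_)).union (h01.compl.inter (MeasurableSet.const _))
  · exact ENNReal.measurable_ofReal.comp measurable_snd
  · exact (κ.measurable_coe measurableSet_Iic).comp measurable_fst

theorem measurable_indicator_quantile_measure (α : Measure ℝ) [IsProbabilityMeasure α] :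
    Measurable ((Set.Ioo (0 : ℝ) 1).indicator (quantile α)) :=
  (measurable_indicator_quantile (Kernel.const Unit α)).comp
    (measurable_const.prodMk measurable_id : Measurable fun t : ℝ => (((), t) : Unit × ℝ))

instance isProbabilityMeasure_restrict_Ioo_zero_one :
    IsProbabilityMeasure (volume.restrict (Set.Ioo (0 : ℝ) 1)) :=
  ⟨by simp⟩

theorem restrict_Ioo_zero_one_Ioi {s : ℝ} (hs : 0 ≤ s) :
    volume.restrict (Set.Ioo (0 : ℝ) 1) (Set.Ioi s) = ENNReal.ofReal (1 - s) := by
  rw [Measure.restrict_apply measurableSet_Ioi, Set.inter_comm, Set.Ioo_inter_Ioi,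
    max_eq_right hs, Real.volume_Ioo]

theorem setOf_lt_indicator_quantile_ae_eq (α : Measure ℝ) [IsProbabilityMeasure α] (a : ℝ) :
    ({t | a < (Set.Ioo (0 : ℝ) 1).indicator (quantile α) t} : Set ℝ)
      =ᵐ[volume.restrict (Set.Ioo (0 : ℝ) 1)] Set.Ioi (cdf α a) := by
  filter_upwards [ae_restrict_mem measurableSet_Ioo] with t ht
  apply propext
  change a < (Set.Ioo (0 : ℝ) 1).indicator (quantile α) t ↔ cdf α a < t
  rw [Set.indicator_of_mem ht, lt_quantile_iff α ht]

theorem measure_Ioi_eq_ofReal_one_sub_cdf (α : Measure ℝ) [IsProbabilityMeasure α] (a : ℝ) :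
    α (Set.Ioi a) = ENNReal.ofReal (1 - cdf α a) := by
  rw [← Set.compl_Iic, prob_compl_eq_one_sub measurableSet_Iic, ← ofReal_cdf,
    ENNReal.ofReal_sub _ (cdf_nonneg _ _), ENNReal.ofReal_one]

theorem measure_lt_indicator_quantile (α : Measure ℝ) [IsProbabilityMeasure α] (a : ℝ) :
    volume.restrict (Set.Ioo (0 : ℝ) 1) {t | a < (Set.Ioo (0 : ℝ) 1).indicator (quantile α) t}
      = α (Set.Ioi a) := by
  rw [measure_congr (setOf_lt_indicator_quantile_ae_eq α a),
    restrict_Ioo_zero_one_Ioi (cdf_nonneg _ _), measure_Ioi_eq_ofReal_one_sub_cdf]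

theorem measure_lt_indicator_quantile_and (α β : Measure ℝ) [IsProbabilityMeasure α]
    [IsProbabilityMeasure β] (a b : ℝ) :
    volume.restrict (Set.Ioo (0 : ℝ) 1) {t | a < (Set.Ioo (0 : ℝ) 1).indicator (quantile α) t ∧
      b < (Set.Ioo (0 : ℝ) 1).indicator (quantile β) t}
      = min (α (Set.Ioi a)) (β (Set.Ioi b)) := by
  have h := (setOf_lt_indicator_quantile_ae_eq α a).inter
    (setOf_lt_indicator_quantile_ae_eq β b)
  rw [Set.Ioi_inter_Ioi] at h
  refine (measure_congr h).trans ?_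
  rw [restrict_Ioo_zero_one_Ioi (le_max_of_le_left (cdf_nonneg _ _)),
    measure_Ioi_eq_ofReal_one_sub_cdf, measure_Ioi_eq_ofReal_one_sub_cdf]
  have : 1 - max (cdf α a) (cdf β b) = min (1 - cdf α a) (1 - cdf β b) := by
    rcases le_total (cdf α a) (cdf β b) with h | h
    · rw [max_eq_right h, min_eq_right (sub_le_sub_left h 1)]
    · rw [max_eq_left h, min_eq_left (sub_le_sub_left h 1)]
  rw [this, ENNReal.ofReal_mono.map_min]

/-- The quantile function pushes Lebesgue measure on `(0, 1)` forward to the measure. -/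
theorem map_indicator_quantile (α : Measure ℝ) [IsProbabilityMeasure α] :
    (volume.restrict (Set.Ioo (0 : ℝ) 1)).map ((Set.Ioo (0 : ℝ) 1).indicator (quantile α)) = α := by
  have := Measure.isProbabilityMeasure_map (μ := volume.restrict (Set.Ioo (0 : ℝ) 1))
    (measurable_indicator_quantile_measure α).aemeasurable
  refine Measure.ext_of_Iic _ _ fun a => ?_
  rw [← Set.compl_Ioi, prob_compl_eq_one_sub measurableSet_Ioi,
    prob_compl_eq_one_sub measurableSet_Ioi,
    Measure.map_apply (measurable_indicator_quantile_measure α) measurableSet_Ioi]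
  exact congrArg _ (measure_lt_indicator_quantile α a)

theorem abs_indicator_quantile_le {α : Measure ℝ} [IsProbabilityMeasure α] {N : ℝ}
    (hN : 0 ≤ N) (hα : ∀ᵐ x ∂α, |x| ≤ N) (t : ℝ) :
    |(Set.Ioo (0 : ℝ) 1).indicator (quantile α) t| ≤ N := by
  by_cases ht : t ∈ Set.Ioo (0 : ℝ) 1
  · rw [Set.indicator_of_mem ht, abs_le]
    constructor
    · refine le_of_forall_lt fun y hy => (lt_quantile_iff α ht y).2 (lt_of_le_of_lt ?_ ht.1)
      rw [cdf_eq_real, Measure.real, measure_eq_zero_iff_ae_notMem.2]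
      · simp
      · filter_upwards [hα] with x hx hxy
        exact absurd ((abs_le.1 hx).1.trans hxy) (not_le.2 hy)
    · refine (quantile_le_iff α ht N).2 (ht.2.le.trans ?_)
      rw [cdf_eq_real, Measure.real, (mem_ae_iff_prob_eq_one measurableSet_Iic).1]
      · simp
      · filter_upwards [hα] with x hx
        exact (abs_le.1 hx).2
  · rw [Set.indicator_of_notMem ht, abs_zero]
    exact hN

theorem lintegral_quantile_le_of_bounded {Ω : Type*} [MeasurableSpace Ω] {π : Measure Ω}
    [IsProbabilityMeasure π] {X Y : Ω → ℝ} (hX : Measurable X) (hY : Measurable Y) {N : ℝ}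
    (hN : 0 ≤ N) (hXN : ∀ ω, |X ω| ≤ N) (hYN : ∀ ω, |Y ω| ≤ N) {c : ℝ × ℝ → ℝ≥0} (hc : Continuous c)
    (hsub : ∀ x x' y y' : ℝ, x ≤ x' → y ≤ y' →
      c (x, y) + c (x', y') ≤ c (x, y') + c (x', y)) :
    ∫⁻ t in Set.Ioo (0 : ℝ) 1, (c (quantile (π.map X) t, quantile (π.map Y) t) : ℝ≥0∞)
      ≤ ∫⁻ ω, (c (X ω, Y ω) : ℝ≥0∞) ∂π := by
  have := Measure.isProbabilityMeasure_map (μ := π) hX.aemeasurable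
  have := Measure.isProbabilityMeasure_map (μ := π) hY.aemeasurable
  have hbd : ∀ {U : Ω → ℝ}, Measurable U → (∀ ω, |U ω| ≤ N) → ∀ᵐ x ∂π.map U, |x| ≤ N :=
    fun hU hUN => (ae_map_iff hU.aemeasurable (measurableSet_le measurable_norm measurable_const)).2
      (Filter.Eventually.of_forall hUN)
  have htail : ∀ {U : Ω → ℝ}, Measurable U → ∀ a, π.map U (Set.Ioi a) = π {ω | a < U ω} :=
    fun hU a => Measure.map_apply hU measurableSet_Ioi
  refine le_trans (le_of_eq ?_) (lintegral_submodular_le_of_concordance_of_bounded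
    (ρ := volume.restrict (Set.Ioo (0 : ℝ) 1)) hX hY
    (measurable_indicator_quantile_measure (π.map X))
    (measurable_indicator_quantile_measure (π.map Y)) hXN hYN
    (abs_indicator_quantile_le hN (hbd hX hXN)) (abs_indicator_quantile_le hN (hbd hY hYN))
    (fun a => ?_) (fun a => ?_) (fun a b => ?_) hc hsub)
  · refine setLIntegral_congr_fun measurableSet_Ioo fun t ht => ?_
    simp only [Set.indicator_of_mem ht]
  · rw [measure_lt_indicator_quantile, htail hX]
  · rw [measure_lt_indicator_quantile, htail hY]
  · rw [measure_lt_indicator_quantile_and, htail hX, htail hY]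
    exact le_min (measure_mono fun _ h => h.1) (measure_mono fun _ h => h.2)

theorem tendsto_quantile_sub {α : Measure ℝ} [IsProbabilityMeasure α] {β : ℕ → Measure ℝ}
    [∀ n, IsProbabilityMeasure (β n)] {ε : ℕ → ℝ} (hε : Filter.Tendsto ε Filter.atTop (nhds 0))
    (hle : ∀ n a, cdf (β n) a ≤ cdf α a + ε n) (hge : ∀ n a, cdf α a - ε n ≤ cdf (β n) a)
    {t : ℝ} (ht : t ∈ Set.Ioo (0 : ℝ) 1) :
    Filter.Tendsto (fun n => quantile (β n) (t - ε n)) Filter.atTop (nhds (quantile α t)) := by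
  have hs : Filter.Tendsto (fun n => t - ε n) Filter.atTop (nhds t) := by
    simpa using tendsto_const_nhds.sub hε
  have hmem : ∀ᶠ n in Filter.atTop, t - ε n ∈ Set.Ioo (0 : ℝ) 1 :=
    hs.eventually (isOpen_Ioo.mem_nhds ht)
  rw [tendsto_order]
  constructor
  · intro y hy
    rw [lt_quantile_iff α ht] at hy
    have h2 : Filter.Tendsto (fun n => cdf α y + ε n) Filter.atTop (nhds (cdf α y)) := by
      simpa using tendsto_const_nhds.add hε
    filter_upwards [hmem, h2.eventually_lt hs hy] with n hn hlt
    exact (lt_quantile_iff _ hn y).2 ((hle n y).trans_lt hlt)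
  · intro y hy
    filter_upwards [hmem] with n hn
    refine lt_of_le_of_lt ((quantile_le_iff _ hn _).2 (le_trans ?_ (hge n _))) hy
    exact sub_le_sub_right ((quantile_le_iff α ht _).1 le_rfl) _

/-- For a continuous submodular cost, the comonotone coupling of two real random variables has the
least expected cost. -/
theorem lintegral_quantile_le {Ω : Type*} [MeasurableSpace Ω] {π : Measure Ω}
    [IsProbabilityMeasure π] {X Y : Ω → ℝ} (hX : Measurable X) (hY : Measurable Y)
    {c : ℝ × ℝ → ℝ≥0} (hc : Continuous c)
    (hsub : ∀ x x' y y' : ℝ, x ≤ x' → y ≤ y' →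
      c (x, y) + c (x', y') ≤ c (x, y') + c (x', y)) :
    ∫⁻ t in Set.Ioo (0 : ℝ) 1, (c (quantile (π.map X) t, quantile (π.map Y) t) : ℝ≥0∞)
      ≤ ∫⁻ ω, (c (X ω, Y ω) : ℝ≥0∞) ∂π := by
  set T : ℕ → Set Ω := fun n => {ω | |X ω| ≤ n ∧ |Y ω| ≤ n} with hT
  have hTm : ∀ n, MeasurableSet (T n) := fun n =>
    (measurableSet_le hX.abs measurable_const).inter (measurableSet_le hY.abs measurable_const)
  have hTmono : Monotone T := fun m n hmn ω hω =>
    ⟨hω.1.trans (Nat.cast_le.2 hmn), hω.2.trans (Nat.cast_le.2 hmn)⟩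
  have hε : Filter.Tendsto (fun n => π (T n)ᶜ) Filter.atTop (nhds 0) := by
    have hempty : ⋂ n, (T n)ᶜ = ∅ := by
      refine Set.eq_empty_of_forall_notMem fun ω hω => ?_
      obtain ⟨n, hn⟩ := exists_nat_ge (max |X ω| |Y ω|)
      exact Set.mem_iInter.1 hω n ⟨(le_max_left _ _).trans hn, (le_max_right _ _).trans hn⟩
    have := tendsto_measure_iInter_atTop (μ := π) (s := fun n => (T n)ᶜ)
      (fun n => (hTm n).compl.nullMeasurableSet)
      (fun m n hmn => Set.compl_subset_compl.2 (hTmono hmn)) ⟨0, measure_ne_top _ _⟩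
    rwa [hempty, measure_empty] at this
  have hε' : Filter.Tendsto (fun n => π.real (T n)ᶜ) Filter.atTop (nhds 0) := by
    simpa [Function.comp_def, Measure.real] using (ENNReal.tendsto_toReal zero_ne_top).comp hε
  have hXn : ∀ n, Measurable ((T n).indicator X) := fun n => hX.indicator (hTm n)
  have hYn : ∀ n, Measurable ((T n).indicator Y) := fun n => hY.indicator (hTm n)
  have := Measure.isProbabilityMeasure_map (μ := π) hX.aemeasurable
  have := Measure.isProbabilityMeasure_map (μ := π) hY.aemeasurable
  have := fun n => Measure.isProbabilityMeasure_map (μ := π) (hXn n).aemeasurable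
  have := fun n => Measure.isProbabilityMeasure_map (μ := π) (hYn n).aemeasurable
  have hcdf : ∀ {U : Ω → ℝ}, Measurable U → ∀ a, [IsProbabilityMeasure (π.map U)] →
      cdf (π.map U) a = π.real {ω | U ω ≤ a} := fun hU a _ => by
    rw [cdf_eq_real, map_measureReal_apply hU measurableSet_Iic]
    rfl
  have hcdf_le : ∀ {U : Ω → ℝ} {n a}, π.real {ω | (T n).indicator U ω ≤ a}
      ≤ π.real {ω | U ω ≤ a} + π.real (T n)ᶜ := fun {U n a} => by
    refine (measureReal_mono (fun ω hω => ?_)).trans (measureReal_union_le _ _)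
    by_cases h : ω ∈ T n
    · left
      simpa [h] using hω
    · exact Or.inr h
  have hcdf_ge : ∀ {U : Ω → ℝ} {n a}, π.real {ω | U ω ≤ a} - π.real (T n)ᶜ
      ≤ π.real {ω | (T n).indicator U ω ≤ a} := fun {U n a} => by
    rw [sub_le_iff_le_add]
    refine (measureReal_mono (fun ω hω => ?_)).trans (measureReal_union_le _ _)
    by_cases h : ω ∈ T n
    · left
      simpa [h] using hω
    · exact Or.inr h
  have hcE : Continuous fun p => (c p : ℝ≥0∞) := ENNReal.continuous_coe.comp hc
  set H : ℕ → ℝ → ℝ≥0∞ := fun n => (Set.Ioo (0 : ℝ) 1).indicator fun t =>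
    (c (quantile (π.map ((T n).indicator X)) t, quantile (π.map ((T n).indicator Y)) t) : ℝ≥0∞)
    with hH
  have hHm : ∀ n, Measurable (H n) := fun n => by
    have : H n = (Set.Ioo (0 : ℝ) 1).indicator fun t =>
        (c ((Set.Ioo (0 : ℝ) 1).indicator (quantile (π.map ((T n).indicator X))) t,
          (Set.Ioo (0 : ℝ) 1).indicator (quantile (π.map ((T n).indicator Y))) t) : ℝ≥0∞) := by
      ext t
      by_cases ht : t ∈ Set.Ioo (0 : ℝ) 1
      · simp only [hH, Set.indicator_of_mem ht]
      · simp only [hH, Set.indicator_of_notMem ht]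
    rw [this]
    exact (hcE.measurable.comp ((measurable_indicator_quantile_measure _).prodMk
      (measurable_indicator_quantile_measure _))).indicator measurableSet_Ioo
  have hpt : ∀ t, (Set.Ioo (0 : ℝ) 1).indicator
      (fun t => (c (quantile (π.map X) t, quantile (π.map Y) t) : ℝ≥0∞)) t
      ≤ Filter.liminf (fun n => H n (t - π.real (T n)ᶜ)) Filter.atTop := by
    intro t
    by_cases ht : t ∈ Set.Ioo (0 : ℝ) 1
    · rw [Set.indicator_of_mem ht]
      have hs : Filter.Tendsto (fun n => t - π.real (T n)ᶜ) Filter.atTop (nhds t) := by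
        simpa using tendsto_const_nhds.sub hε'
      have hmem := hs.eventually (isOpen_Ioo.mem_nhds ht)
      have hq : Filter.Tendsto (fun n =>
          (c (quantile (π.map ((T n).indicator X)) (t - π.real (T n)ᶜ),
            quantile (π.map ((T n).indicator Y)) (t - π.real (T n)ᶜ)) : ℝ≥0∞)) Filter.atTop
          (nhds (c (quantile (π.map X) t, quantile (π.map Y) t) : ℝ≥0∞)) := by
        refine (hcE.tendsto _).comp (Filter.Tendsto.prodMk_nhds ?_ ?_)
        · refine tendsto_quantile_sub hε' (fun n a => ?_) (fun n a => ?_) ht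
          · rw [hcdf hX, hcdf (hXn n)]
            exact hcdf_le
          · rw [hcdf hX, hcdf (hXn n)]
            exact hcdf_ge
        · refine tendsto_quantile_sub hε' (fun n a => ?_) (fun n a => ?_) ht
          · rw [hcdf hY, hcdf (hYn n)]
            exact hcdf_le
          · rw [hcdf hY, hcdf (hYn n)]
            exact hcdf_ge
      refine (Filter.Tendsto.liminf_eq (hq.congr' ?_)).ge
      filter_upwards [hmem] with n hn
      simp only [hH]
      rw [Set.indicator_of_mem (s := Set.Ioo (0 : ℝ) 1) hn]
    · rw [Set.indicator_of_notMem ht]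
      exact zero_le
  have hbound : ∀ n, ∫⁻ t, H n (t - π.real (T n)ᶜ)
      ≤ ∫⁻ ω, (c (X ω, Y ω) : ℝ≥0∞) ∂π + c (0, 0) * π (T n)ᶜ := by
    intro n
    rw [lintegral_sub_right_eq_self (H n), lintegral_indicator measurableSet_Ioo]
    have hind : ∀ (U : Ω → ℝ), (∀ ω ∈ T n, |U ω| ≤ n) → ∀ ω, |(T n).indicator U ω| ≤ n := by
      intro U hU ω
      by_cases h : ω ∈ T n
      · simpa [h] using hU ω h
      · simp [h]
    refine (lintegral_quantile_le_of_bounded (hXn n) (hYn n) (Nat.cast_nonneg n)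
      (hind X fun ω h => h.1) (hind Y fun ω h => h.2) hc hsub).trans ?_
    rw [← lintegral_indicator_const (hTm n).compl,
      ← lintegral_add_right _ (measurable_const.indicator (hTm n).compl)]
    refine lintegral_mono fun ω => ?_
    by_cases h : ω ∈ T n <;> simp [h]
  rw [← lintegral_indicator measurableSet_Ioo]
  refine (lintegral_mono hpt).trans ((lintegral_liminf_le fun n =>
    (hHm n).comp (measurable_id.sub_const _)).trans
    ((Filter.liminf_le_liminf (Filter.Eventually.of_forall hbound)).trans (le_of_eq ?_)))
  refine Filter.Tendsto.liminf_eq ?_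
  simpa using tendsto_const_nhds.add (ENNReal.Tendsto.const_mul hε (Or.inr coe_ne_top))

section Density

variable {X : Type*} [MeasurableSpace X] {d : ℕ}

theorem lintegral_avgProb (μ : Fin d → Measure X) (f : X → ℝ≥0∞) :
    ∫⁻ x, f x ∂(avgProb μ) = (d : ℝ≥0∞)⁻¹ * ∑ j, ∫⁻ x, f x ∂(μ j) := by
  rw [avgProb, lintegral_smul_measure, lintegral_finsetSum_measure, smul_eq_mul]

theorem isProbabilityMeasure_avgProb [NeZero d] (μ : Fin d → Measure X)
    [∀ j, IsProbabilityMeasure (μ j)] : IsProbabilityMeasure (avgProb μ) := by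
  refine ⟨?_⟩
  have := lintegral_avgProb μ 1
  simp only [Pi.one_apply, lintegral_one, measure_univ, Finset.sum_const, Finset.card_univ,
    Fintype.card_fin, nsmul_eq_mul, mul_one] at this
  rw [this, ENNReal.inv_mul_cancel (by simpa using NeZero.ne d) (by simp)]

theorem le_smul_avgProb [NeZero d] (μ : Fin d → Measure X) (j : Fin d) :
    μ j ≤ (d : ℝ≥0∞) • avgProb μ := by
  rw [avgProb, smul_smul, ENNReal.mul_inv_cancel (by simpa using NeZero.ne d) (by simp), one_smul]
  exact Measure.le_sum μ j |>.trans (by rw [Measure.sum_fintype])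

theorem absolutelyContinuous_avgProb [NeZero d] (μ : Fin d → Measure X) (j : Fin d) :
    μ j ≪ avgProb μ :=
  Measure.absolutelyContinuous_of_le_smul (le_smul_avgProb μ j)

theorem measurable_densityVec (μ : Fin d → Measure X) : Measurable (densityVec μ) :=
  measurable_pi_lambda _ fun _ => (Measure.measurable_rnDeriv _ _).ennreal_toReal

theorem measurable_ofReal_densityVec (μ : Fin d → Measure X) (j : Fin d) :
    Measurable fun x => ENNReal.ofReal (densityVec μ x j) :=
  ((measurable_pi_apply j).comp (measurable_densityVec μ)).ennreal_ofReal

variable [NeZero d] (μ : Fin d → Measure X) [∀ j, IsProbabilityMeasure (μ j)]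

theorem ofReal_densityVec_ae_eq (j : Fin d) :
    (fun x => ENNReal.ofReal (densityVec μ x j)) =ᵐ[avgProb μ] (μ j).rnDeriv (avgProb μ) := by
  have := isProbabilityMeasure_avgProb μ
  filter_upwards [Measure.rnDeriv_ne_top (μ j) (avgProb μ)] with x hx
  exact ENNReal.ofReal_toReal hx

theorem ofReal_densityVec_ae_le (j : Fin d) :
    ∀ᵐ x ∂avgProb μ, ENNReal.ofReal (densityVec μ x j) ≤ d := by
  have := isProbabilityMeasure_avgProb μ
  refine ae_le_of_forall_setLIntegral_le_of_sigmaFinite (measurable_ofReal_densityVec μ j)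
    fun s hs _ => ?_
  rw [setLIntegral_const, lintegral_congr_ae (ae_restrict_of_ae (ofReal_densityVec_ae_eq μ j))]
  exact (Measure.setLIntegral_rnDeriv_le s).trans (le_smul_avgProb μ j s)

theorem lintegral_eq_lintegral_densityVec_mul (j : Fin d) {f : X → ℝ≥0∞} (hf : Measurable f) :
    ∫⁻ x, f x ∂(μ j) = ∫⁻ x, ENNReal.ofReal (densityVec μ x j) * f x ∂(avgProb μ) := by
  have := isProbabilityMeasure_avgProb μ
  rw [← lintegral_rnDeriv_mul (absolutelyContinuous_avgProb μ j) hf.aemeasurable]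
  refine lintegral_congr_ae ?_
  filter_upwards [ofReal_densityVec_ae_eq μ j] with x hx
  rw [hx]

end Density

theorem ae_eq_of_lintegral_mul_eq {Ω : Type*} [MeasurableSpace Ω] {π : Measure Ω}
    {A B : Ω → ℝ≥0∞} (hA : Measurable A) (hB : Measurable B)
    (hAA : ∫⁻ ω, A ω * A ω ∂π ≠ ∞)
    (h1 : ∫⁻ ω, A ω * A ω ∂π = ∫⁻ ω, B ω * B ω ∂π)
    (h2 : ∫⁻ ω, A ω * B ω ∂π = ∫⁻ ω, B ω * B ω ∂π) : A =ᵐ[π] B := by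
  have aux : ∀ a b : ℝ≥0∞, a ≤ b →
      a * a + b * b = 2 * (a * b) + ((a - b) * (a - b) + (b - a) * (b - a)) := fun a b hab => by
    obtain ⟨D, rfl⟩ := exists_add_of_le hab
    by_cases ha : a = ∞
    · simp [ha]
    · rw [tsub_eq_zero_of_le hab, ENNReal.add_sub_cancel_left ha]
      ring
  have hid : ∀ ω, A ω * A ω + B ω * B ω = 2 * (A ω * B ω)
      + ((A ω - B ω) * (A ω - B ω) + (B ω - A ω) * (B ω - A ω)) := fun ω => by
    rcases le_total (A ω) (B ω) with h | h
    · exact aux _ _ h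
    · rw [add_comm, aux _ _ h, mul_comm (A ω) (B ω), add_comm ((A ω - B ω) * _)]
  have hm : Measurable fun ω =>
      (A ω - B ω) * (A ω - B ω) + (B ω - A ω) * (B ω - A ω) :=
    ((hA.sub hB).mul (hA.sub hB)).add ((hB.sub hA).mul (hB.sub hA))
  have hint := lintegral_congr (μ := π) hid
  have hAAm : Measurable fun ω => A ω * A ω := hA.mul hA
  have hABm : Measurable fun ω => A ω * B ω := hA.mul hB
  rw [lintegral_add_left hAAm, lintegral_add_left (hABm.const_mul 2),
    lintegral_const_mul _ hABm, h2, ← h1, ← two_mul] at hint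
  have hzero : ∫⁻ ω, ((A ω - B ω) * (A ω - B ω) + (B ω - A ω) * (B ω - A ω)) ∂π = 0 := by
    have hfin : 2 * ∫⁻ ω, A ω * A ω ∂π ≠ ∞ := ENNReal.mul_ne_top (by simp) hAA
    exact (ENNReal.add_right_inj hfin).1 (by rw [← hint, add_zero])
  filter_upwards [(lintegral_eq_zero_iff hm).1 hzero] with ω hω
  simp only [Pi.zero_apply, add_eq_zero, mul_self_eq_zero, tsub_eq_zero_iff_le] at hω
  exact le_antisymm hω.1 hω.2

section Transport

variable {d : ℕ} {μ ν : Fin d → Measure ℝ}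

theorem comp_eq_of_forall_le [∀ j, IsProbabilityMeasure (μ j)]
    [∀ j, IsProbabilityMeasure (ν j)] {κ : Kernel ℝ ℝ} [IsMarkovKernel κ]
    (h : ∀ j, ∀ B : Set ℝ, MeasurableSet B → ν j B ≤ ∫⁻ x, κ x B ∂(μ j)) (j : Fin d) :
    κ ∘ₘ μ j = ν j := by
  refine (Measure.eq_of_le_of_measure_univ_eq (Measure.le_iff.2 fun B hB => ?_) ?_).symm
  · rw [Measure.bind_apply hB κ.aemeasurable]
    exact h j B hB
  · rw [measure_univ, measure_univ]

theorem comp_avgProb {κ : Kernel ℝ ℝ} [IsMarkovKernel κ] (h : ∀ j, κ ∘ₘ μ j = ν j) :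
    κ ∘ₘ avgProb μ = avgProb ν := by
  refine Measure.ext_of_lintegral _ fun f hf => ?_
  rw [Measure.lintegral_bind κ.aemeasurable hf.aemeasurable, lintegral_avgProb, lintegral_avgProb]
  refine congrArg _ (Finset.sum_congr rfl fun j _ => ?_)
  rw [← h j, Measure.lintegral_bind κ.aemeasurable hf.aemeasurable]

variable [NeZero d] [∀ j, IsProbabilityMeasure (μ j)]

theorem lintegral_snd_compProd_avgProb {κ : Kernel ℝ ℝ} [IsMarkovKernel κ]
    (h : ∀ j, κ ∘ₘ μ j = ν j) {f : ℝ → ℝ≥0∞} (hf : Measurable f) :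
    ∫⁻ p, f p.2 ∂(avgProb μ ⊗ₘ κ) = ∫⁻ y, f y ∂(avgProb ν) := by
  have := isProbabilityMeasure_avgProb μ
  rw [Measure.lintegral_compProd (f := fun p => f p.2) (hf.comp measurable_snd), ← comp_avgProb h,
    Measure.lintegral_bind κ.aemeasurable hf.aemeasurable]

/-- A simultaneous transport between tuples with the same law of densities only moves mass
between points at which the densities agree. -/
theorem densityVec_ae_eq_of_comp_eq [∀ j, IsProbabilityMeasure (ν j)]
    (hP : mMeasure μ = mMeasure ν) {κ : Kernel ℝ ℝ} [IsMarkovKernel κ] (h : ∀ j, κ ∘ₘ μ j = ν j) :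
    ∀ᵐ p ∂(avgProb μ ⊗ₘ κ), densityVec μ p.1 = densityVec ν p.2 := by
  have := isProbabilityMeasure_avgProb μ
  have hj : ∀ j, (fun p : ℝ × ℝ => ENNReal.ofReal (densityVec μ p.1 j))
      =ᵐ[avgProb μ ⊗ₘ κ] fun p => ENNReal.ofReal (densityVec ν p.2 j) := by
    intro j
    set a : ℝ → ℝ≥0∞ := fun x => ENNReal.ofReal (densityVec μ x j)
    set b : ℝ → ℝ≥0∞ := fun y => ENNReal.ofReal (densityVec ν y j)
    have ha : Measurable a := measurable_ofReal_densityVec μ j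
    have hb : Measurable b := measurable_ofReal_densityVec ν j
    have haa : ∫⁻ p, a p.1 * a p.1 ∂(avgProb μ ⊗ₘ κ) = ∫⁻ x, a x * a x ∂(avgProb μ) := by
      rw [Measure.lintegral_compProd (f := fun p => a p.1 * a p.1) (by fun_prop)]
      simp
    have hbb : ∫⁻ p, b p.2 * b p.2 ∂(avgProb μ ⊗ₘ κ) = ∫⁻ y, b y * b y ∂(avgProb ν) :=
      lintegral_snd_compProd_avgProb h (hb.mul hb)
    have hlaw : ∀ τ : Fin d → Measure ℝ,
        ∫⁻ x, ENNReal.ofReal (densityVec τ x j) * ENNReal.ofReal (densityVec τ x j) ∂(avgProb τ)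
          = ∫⁻ z, ENNReal.ofReal (z j) * ENNReal.ofReal (z j) ∂(mMeasure τ) := fun τ => by
      rw [mMeasure, lintegral_map (by fun_prop) (measurable_densityVec τ)]
    have hab : ∫⁻ x, a x * a x ∂(avgProb μ) = ∫⁻ y, b y * b y ∂(avgProb ν) := by
      rw [hlaw μ, hlaw ν, hP]
    refine ae_eq_of_lintegral_mul_eq (ha.comp measurable_fst) (hb.comp measurable_snd) ?_ ?_ ?_
    · refine haa.trans_ne (ne_top_of_le_ne_top (b := ∫⁻ _, (d : ℝ≥0∞) * d ∂(avgProb μ)) ?_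
        (lintegral_mono_ae ?_))
      · rw [lintegral_const, measure_univ, mul_one]
        exact ENNReal.mul_ne_top (by simp) (by simp)
      · filter_upwards [ofReal_densityVec_ae_le μ j] with x hx
        exact mul_le_mul' hx hx
    · exact haa.trans (hab.trans hbb.symm)
    · refine Eq.trans ?_ hbb.symm
      change ∫⁻ p, a p.1 * b p.2 ∂(avgProb μ ⊗ₘ κ) = _
      rw [Measure.lintegral_compProd (f := fun p => a p.1 * b p.2) (by fun_prop),
        ← lintegral_eq_lintegral_densityVec_mul ν j hb, ← h j,
        Measure.lintegral_bind κ.aemeasurable hb.aemeasurable,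
        lintegral_eq_lintegral_densityVec_mul μ j hb.lintegral_kernel]
      exact lintegral_congr fun x => lintegral_const_mul (a x) hb
  filter_upwards [ae_all_iff.2 hj] with p hp
  funext j
  exact (ENNReal.ofReal_eq_ofReal_iff ENNReal.toReal_nonneg ENNReal.toReal_nonneg).1 (hp j)

end Transport

section Disintegration

variable {d : ℕ} {X : Type*} [MeasurableSpace X] {μ : Fin d → Measure X}
  {P : Measure (Fin d → ℝ)}

/-- A disintegration agrees almost everywhere with a Markov kernel. -/
theorem IsDisintegration.exists_kernel [Nonempty X] {μz : (Fin d → ℝ) → Measure X}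
    (h : IsDisintegration μ P μz) :
    ∃ η : Kernel (Fin d → ℝ) X, IsMarkovKernel η ∧ (∀ᵐ z ∂P, η z = μz z) ∧
      (∀ᵐ z ∂P, ∀ᵐ x ∂(η z), densityVec μ x = z) ∧ avgProb μ = η ∘ₘ P := by
  classical
  obtain ⟨hmeas, hprob, hsupp, hint⟩ := h
  obtain ⟨x₀⟩ := ‹Nonempty X›
  let S : Set (Fin d → ℝ) := {z | μz z Set.univ = 1}
  have hS : MeasurableSet S := hmeas _ MeasurableSet.univ (measurableSet_singleton 1)
  let κ : Kernel (Fin d → ℝ) X := ⟨μz, Measure.measurable_of_measurable_coe μz hmeas⟩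
  let η : Kernel (Fin d → ℝ) X := Kernel.piecewise hS κ (Kernel.const _ (Measure.dirac x₀))
  have hη : ∀ᵐ z ∂P, η z = μz z := by
    filter_upwards [hprob] with z hz
    have hzS : z ∈ S := hz.measure_univ
    simp only [η, Kernel.piecewise_apply, if_pos hzS]
    rfl
  refine ⟨η, ⟨fun z => ?_⟩, hη, ?_, ?_⟩
  · by_cases hz : z ∈ S
    · simp only [η, Kernel.piecewise_apply, if_pos hz]
      exact ⟨hz⟩
    · simp only [η, Kernel.piecewise_apply, if_neg hz, Kernel.const_apply]
      infer_instance
  · filter_upwards [hη, hsupp] with z hz hz'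
    rw [hz]
    exact hz'
  · ext A hA
    rw [hint A hA, Measure.bind_apply hA η.aemeasurable]
    refine lintegral_congr_ae ?_
    filter_upwards [hη] with z hz
    rw [hz]

variable {η : Kernel (Fin d → ℝ) X}

theorem lintegral_densityVec_prodMk (hsupp : ∀ᵐ z ∂P, ∀ᵐ x ∂(η z), densityVec μ x = z)
    (hbar : avgProb μ = η ∘ₘ P) {f : (Fin d → ℝ) × X → ℝ≥0∞} (hf : Measurable f) :
    ∫⁻ x, f (densityVec μ x, x) ∂(avgProb μ) = ∫⁻ z, ∫⁻ x, f (z, x) ∂(η z) ∂P := by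
  have hm : Measurable fun x => f (densityVec μ x, x) :=
    hf.comp ((measurable_densityVec μ).prodMk measurable_id)
  conv_lhs => rw [hbar]
  rw [Measure.lintegral_bind η.aemeasurable hm.aemeasurable]
  refine lintegral_congr_ae ?_
  filter_upwards [hsupp] with z hz
  refine lintegral_congr_ae ?_
  filter_upwards [hz] with x hx
  rw [hx]

theorem lintegral_eq_lintegral_disintegration [NeZero d] [∀ j, IsProbabilityMeasure (μ j)]
    (hsupp : ∀ᵐ z ∂P, ∀ᵐ x ∂(η z), densityVec μ x = z) (hbar : avgProb μ = η ∘ₘ P) (j : Fin d)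
    {f : X → ℝ≥0∞} (hf : Measurable f) :
    ∫⁻ x, f x ∂(μ j) = ∫⁻ z, ENNReal.ofReal (z j) * ∫⁻ x, f x ∂(η z) ∂P := by
  rw [lintegral_eq_lintegral_densityVec_mul μ j hf,
    lintegral_densityVec_prodMk (f := fun p => ENNReal.ofReal (p.1 j) * f p.2) hsupp hbar
      (by fun_prop)]
  exact lintegral_congr fun z => lintegral_const_mul (ENNReal.ofReal (z j)) hf

end Disintegration

section Cost

variable {d : ℕ} [NeZero d] {μ ν : Fin d → Measure ℝ} [∀ j, IsProbabilityMeasure (μ j)]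
  [∀ j, IsProbabilityMeasure (ν j)] {P : Measure (Fin d → ℝ)} [IsFiniteMeasure P]
  {η θ : Kernel (Fin d → ℝ) ℝ} [IsMarkovKernel η] [IsMarkovKernel θ]

/-- A simultaneous transport maps the slices of `μ` to the corresponding slices of `ν`. -/
theorem comp_disintegration_ae_eq (hP : mMeasure μ = mMeasure ν)
    (hη : ∀ᵐ z ∂P, ∀ᵐ x ∂(η z), densityVec μ x = z) (hηbar : avgProb μ = η ∘ₘ P)
    (hθ : ∀ᵐ z ∂P, ∀ᵐ y ∂(θ z), densityVec ν y = z) (hθbar : avgProb ν = θ ∘ₘ P)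
    {κ : Kernel ℝ ℝ} [IsMarkovKernel κ] (h : ∀ j, κ ∘ₘ μ j = ν j) :
    ∀ᵐ z ∂P, κ ∘ₘ η z = θ z := by
  have := isProbabilityMeasure_avgProb μ
  have hcomp : P ⊗ₘ (κ ∘ₖ η) = P ⊗ₘ θ := by
    refine Measure.ext_of_lintegral _ fun f hf => ?_
    have hfν : Measurable fun y => f (densityVec ν y, y) :=
      hf.comp ((measurable_densityVec ν).prodMk measurable_id)
    have hfμ : Measurable fun p : ℝ × ℝ => f (densityVec μ p.1, p.2) :=
      hf.comp (((measurable_densityVec μ).comp measurable_fst).prodMk measurable_snd)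
    have hF : Measurable fun p : (Fin d → ℝ) × ℝ => ∫⁻ y, f (p.1, y) ∂(κ p.2) :=
      Measurable.lintegral_kernel_prod_right' (κ := κ.comap Prod.snd measurable_snd)
        (f := fun q : ((Fin d → ℝ) × ℝ) × ℝ => f (q.1.1, q.2)) (by fun_prop)
    rw [Measure.lintegral_compProd hf, Measure.lintegral_compProd hf,
      ← lintegral_densityVec_prodMk hθ hθbar hf, ← lintegral_snd_compProd_avgProb h hfν]
    calc ∫⁻ z, ∫⁻ y, f (z, y) ∂((κ ∘ₖ η) z) ∂P
        = ∫⁻ z, ∫⁻ x, ∫⁻ y, f (z, y) ∂(κ x) ∂(η z) ∂P :=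
          lintegral_congr fun z => Kernel.lintegral_comp _ _ _ (by fun_prop)
      _ = ∫⁻ x, ∫⁻ y, f (densityVec μ x, y) ∂(κ x) ∂(avgProb μ) :=
          (lintegral_densityVec_prodMk hη hηbar hF).symm
      _ = ∫⁻ p, f (densityVec μ p.1, p.2) ∂(avgProb μ ⊗ₘ κ) :=
          (Measure.lintegral_compProd hfμ).symm
      _ = ∫⁻ p, f (densityVec ν p.2, p.2) ∂(avgProb μ ⊗ₘ κ) := by
          refine lintegral_congr_ae ?_
          filter_upwards [densityVec_ae_eq_of_comp_eq hP h] with p hp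
          rw [hp]
  filter_upwards [Kernel.ae_eq_of_compProd_eq hcomp] with z hz
  rw [← hz, Kernel.comp_apply]

theorem lintegral_quantile_le_cost (hP : mMeasure μ = mMeasure ν)
    (hη : ∀ᵐ z ∂P, ∀ᵐ x ∂(η z), densityVec μ x = z) (hηbar : avgProb μ = η ∘ₘ P)
    (hθ : ∀ᵐ z ∂P, ∀ᵐ y ∂(θ z), densityVec ν y = z) (hθbar : avgProb ν = θ ∘ₘ P)
    {κ : Kernel ℝ ℝ} [IsMarkovKernel κ] (h : ∀ j, κ ∘ₘ μ j = ν j)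
    {c : ℝ × ℝ → ℝ≥0} (hc : Continuous c)
    (hsub : ∀ x x' y y' : ℝ, x ≤ x' → y ≤ y' →
      c (x, y) + c (x', y') ≤ c (x, y') + c (x', y)) :
    ∫⁻ z, (∫⁻ t in Set.Ioo (0 : ℝ) 1, (c (quantile (η z) t, quantile (θ z) t) : ℝ≥0∞)) ∂P
      ≤ ∫⁻ x, ∫⁻ y, (c (x, y) : ℝ≥0∞) ∂(κ x) ∂(avgProb μ) := by
  have hcm : Measurable fun p => (c p : ℝ≥0∞) := (ENNReal.continuous_coe.comp hc).measurable
  rw [hηbar, Measure.lintegral_bind η.aemeasurable hcm.lintegral_kernel_prod_right'.aemeasurable]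
  refine lintegral_mono_ae ?_
  filter_upwards [comp_disintegration_ae_eq hP hη hηbar hθ hθbar h] with z hz
  have key := lintegral_quantile_le (π := η z ⊗ₘ κ) measurable_fst measurable_snd hc hsub
  have h1 : (η z ⊗ₘ κ).map Prod.fst = η z := Measure.fst_compProd (η z) κ
  have h2 : (η z ⊗ₘ κ).map Prod.snd = θ z := (Measure.snd_compProd (η z) κ).trans hz
  rw [h1, h2] at key
  exact key.trans_eq (Measure.lintegral_compProd hcm)

/-- Coupling the slices comonotonically is realised by a simultaneous transport kernel. -/
theorem exists_kernel_cost_eq_lintegral_quantile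
    (hη : ∀ᵐ z ∂P, ∀ᵐ x ∂(η z), densityVec μ x = z) (hηbar : avgProb μ = η ∘ₘ P)
    (hθ : ∀ᵐ z ∂P, ∀ᵐ y ∂(θ z), densityVec ν y = z) (hθbar : avgProb ν = θ ∘ₘ P)
    {c : ℝ × ℝ → ℝ≥0∞} (hc : Measurable c) :
    ∃ κ : Kernel ℝ ℝ, IsMarkovKernel κ ∧ (∀ j, κ ∘ₘ μ j = ν j) ∧
      ∫⁻ x, ∫⁻ y, c (x, y) ∂(κ x) ∂(avgProb μ)
        = ∫⁻ z, (∫⁻ t in Set.Ioo (0 : ℝ) 1, c (quantile (η z) t, quantile (θ z) t)) ∂P := by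
  have hqη := measurable_indicator_quantile η
  have hqθ := measurable_indicator_quantile θ
  have hq := hqη.prodMk hqθ
  let ρ : Measure (ℝ × ℝ) := (P.prod (volume.restrict (Set.Ioo (0 : ℝ) 1))).map
    fun p => ((Set.Ioo (0 : ℝ) 1).indicator (quantile (η p.1)) p.2,
      (Set.Ioo (0 : ℝ) 1).indicator (quantile (θ p.1)) p.2)
  have hρ : ∀ f : ℝ × ℝ → ℝ≥0∞, Measurable f → ∫⁻ p, f p ∂ρ
      = ∫⁻ z, (∫⁻ t in Set.Ioo (0 : ℝ) 1, f ((Set.Ioo (0 : ℝ) 1).indicator (quantile (η z)) t,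
        (Set.Ioo (0 : ℝ) 1).indicator (quantile (θ z)) t)) ∂P := fun f hf => by
    rw [lintegral_map hf hq]
    exact lintegral_prod _ (hf.comp hq).aemeasurable
  have hmapη : ∀ (f : ℝ → ℝ≥0∞) (z), Measurable f →
      ∫⁻ t in Set.Ioo (0 : ℝ) 1, f ((Set.Ioo (0 : ℝ) 1).indicator (quantile (η z)) t)
        = ∫⁻ x, f x ∂(η z) := fun f z hf => by
    conv_rhs => rw [← map_indicator_quantile (η z)]
    rw [lintegral_map hf (measurable_indicator_quantile_measure _)]
  have hmapθ : ∀ (f : ℝ → ℝ≥0∞) (z), Measurable f →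
      ∫⁻ t in Set.Ioo (0 : ℝ) 1, f ((Set.Ioo (0 : ℝ) 1).indicator (quantile (θ z)) t)
        = ∫⁻ x, f x ∂(θ z) := fun f z hf => by
    conv_rhs => rw [← map_indicator_quantile (θ z)]
    rw [lintegral_map hf (measurable_indicator_quantile_measure _)]
  have hfst : ρ.fst = avgProb μ := by
    refine Measure.ext_of_lintegral _ fun f hf => ?_
    rw [Measure.fst, lintegral_map hf measurable_fst,
      hρ (fun p => f p.1) (hf.comp measurable_fst), hηbar,
      Measure.lintegral_bind η.aemeasurable hf.aemeasurable]
    exact lintegral_congr fun z => hmapη f z hf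
  have hρκ : avgProb μ ⊗ₘ ρ.condKernel = ρ := by
    rw [← hfst]
    exact ρ.disintegrate ρ.condKernel
  have := isProbabilityMeasure_avgProb μ
  refine ⟨ρ.condKernel, inferInstance, fun j => ?_, ?_⟩
  · refine Measure.ext_of_lintegral _ fun f hf => ?_
    have hW := measurable_ofReal_densityVec μ j
    have hWf : Measurable fun p : ℝ × ℝ => ENNReal.ofReal (densityVec μ p.1 j) * f p.2 :=
      (hW.comp measurable_fst).mul (hf.comp measurable_snd)
    rw [Measure.lintegral_bind ρ.condKernel.aemeasurable hf.aemeasurable,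
      lintegral_eq_lintegral_densityVec_mul μ j hf.lintegral_kernel,
      lintegral_eq_lintegral_disintegration hθ hθbar j hf]
    calc ∫⁻ x, ENNReal.ofReal (densityVec μ x j) * ∫⁻ y, f y ∂(ρ.condKernel x) ∂(avgProb μ)
        = ∫⁻ x, ∫⁻ y, ENNReal.ofReal (densityVec μ x j) * f y ∂(ρ.condKernel x) ∂(avgProb μ) :=
          lintegral_congr fun x => (lintegral_const_mul _ hf).symm
      _ = ∫⁻ p, ENNReal.ofReal (densityVec μ p.1 j) * f p.2 ∂ρ := by
          conv_rhs => rw [← hρκ]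
          rw [Measure.lintegral_compProd hWf]
      _ = ∫⁻ z, ENNReal.ofReal (z j) * ∫⁻ y, f y ∂(θ z) ∂P := by
          rw [hρ _ hWf]
          refine lintegral_congr_ae ?_
          filter_upwards [hη] with z hz
          have hfθ : Measurable fun t =>
              f ((Set.Ioo (0 : ℝ) 1).indicator (quantile (θ z)) t) :=
            hf.comp (measurable_indicator_quantile_measure _)
          rw [← hmapθ f z hf, ← lintegral_const_mul _ hfθ]
          refine lintegral_congr_ae ?_
          have hz' := hz
          rw [← map_indicator_quantile (η z)] at hz'
          filter_upwards [ae_of_ae_map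
            (measurable_indicator_quantile_measure (η z)).aemeasurable hz'] with t ht
          simp only [ht]
  · rw [← Measure.lintegral_compProd hc, hρκ, hρ c hc]
    refine lintegral_congr fun z => setLIntegral_congr_fun measurableSet_Ioo fun t ht => ?_
    simp only [Set.indicator_of_mem ht]

end Cost

/-- for a continuous submodular cost on `ℝ × ℝ` and `m_μ = m_ν = P`, the
simultaneous optimal transport cost equals the integral over `P` of the comonotone
(quantile-coupling) costs of the slices. -/
theorem sot_submodular_quantile_formula
    {d : ℕ} (μ : Fin d → Measure ℝ) (ν : Fin d → Measure ℝ)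
    (hμ : ∀ j, IsProbabilityMeasure (μ j)) (hν : ∀ j, IsProbabilityMeasure (ν j))
    (c : ℝ × ℝ → ℝ≥0) (hc : Continuous c)
    (hsub : ∀ x x' y y' : ℝ, x ≤ x' → y ≤ y' →
      c (x, y) + c (x', y') ≤ c (x, y') + c (x', y))
    (P : Measure (Fin d → ℝ)) (hPμ : mMeasure μ = P) (hPν : mMeasure ν = P)
    (μz : (Fin d → ℝ) → Measure ℝ) (hμz : IsDisintegration μ P μz)
    (νz : (Fin d → ℝ) → Measure ℝ) (hνz : IsDisintegration ν P νz) :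
    sotInfCost μ ν (fun p => (c p : ℝ≥0∞))
      = ∫⁻ z, (∫⁻ t in Set.Ioo (0 : ℝ) 1,
          (c (quantile (μz z) t, quantile (νz z) t) : ℝ≥0∞)) ∂P := by
  rcases Nat.eq_zero_or_pos d with rfl | hd
  · have havg : avgProb μ = 0 := by simp [avgProb]
    have hP0 : P = 0 := by rw [← hPμ, mMeasure, havg, Measure.map_zero]
    rw [hP0, lintegral_zero_measure]
    refine le_antisymm (sInf_le ⟨Kernel.id, inferInstance, fun j => j.elim0, ?_⟩) zero_le
    rw [havg, lintegral_zero_measure]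
  have : NeZero d := ⟨hd.ne'⟩
  have := isProbabilityMeasure_avgProb μ
  have hPprob : IsProbabilityMeasure P := by
    rw [← hPμ]
    exact Measure.isProbabilityMeasure_map (measurable_densityVec μ).aemeasurable
  obtain ⟨η, _, hηz, hη, hηbar⟩ := hμz.exists_kernel
  obtain ⟨θ, _, hθz, hθ, hθbar⟩ := hνz.exists_kernel
  have hrhs : ∫⁻ z, (∫⁻ t in Set.Ioo (0 : ℝ) 1,
        (c (quantile (μz z) t, quantile (νz z) t) : ℝ≥0∞)) ∂P
      = ∫⁻ z, (∫⁻ t in Set.Ioo (0 : ℝ) 1,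
        (c (quantile (η z) t, quantile (θ z) t) : ℝ≥0∞)) ∂P := by
    refine lintegral_congr_ae ?_
    filter_upwards [hηz, hθz] with z h1 h2
    rw [h1, h2]
  rw [hrhs]
  refine le_antisymm (sInf_le ?_) (le_sInf ?_)
  · obtain ⟨κ, hκ, hκν, hcost⟩ := exists_kernel_cost_eq_lintegral_quantile hη hηbar hθ hθbar
      (ENNReal.continuous_coe.comp hc).measurable
    refine ⟨κ, hκ, fun j B hB => ?_, hcost.symm⟩
    rw [← hκν j, Measure.bind_apply hB κ.aemeasurable]
  · rintro r ⟨κ, _, hκν, rfl⟩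
    exact lintegral_quantile_le_cost (hPμ.trans hPν.symm) hη hηbar hθ hθbar
      (comp_eq_of_forall_le hκν) hc hsub

end
end

section
/- Let N ≥ 1 and let μ = (μ₁,μ₂) and ν = (ν₁,ν₂) be pairs of Gaussian probability measures on ℝ^N with positive densities everywhere (i.e. with invertible covariance matrices). Then m_μ = m_ν if and only if there exist an invertible N×N real matrix A and a vector b ∈ ℝ^N such that, with T(x) = Ax + b, the pushforward of μⱼ under T equals νⱼ for j = 1, 2. -/
open MeasureTheory ProbabilityTheory ENNReal Matrix

noncomputable section

/-- Density of the Gaussian distribution on `ℝ^N` with mean `b` and covariance matrix `S`. -/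
def gaussianDensity {N : ℕ} (b : Fin N → ℝ) (S : Matrix (Fin N) (Fin N) ℝ)
    (x : Fin N → ℝ) : ℝ :=
  (Real.sqrt ((2 * Real.pi) ^ N * S.det))⁻¹ *
    Real.exp (-(1 / 2 : ℝ) * ((x - b) ⬝ᵥ (S⁻¹ *ᵥ (x - b))))

/-- The Gaussian measure on `ℝ^N` with mean `b` and covariance matrix `S`. -/
def gaussianMeasure {N : ℕ} (b : Fin N → ℝ) (S : Matrix (Fin N) (Fin N) ℝ) :
    Measure (Fin N → ℝ) :=
  volume.withDensity fun x => ENNReal.ofReal (gaussianDensity b S x)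

/-- Average probability measure of a pair of probability measures. -/
def avgPair {X : Type*} [MeasurableSpace X] (μ₁ μ₂ : Measure X) : Measure X :=
  (2 : ℝ≥0∞)⁻¹ • (μ₁ + μ₂)

/-- The law on `ℝ²` of the pair of Radon–Nikodym derivatives with respect to the average. -/
def mPair {X : Type*} [MeasurableSpace X] (μ₁ μ₂ : Measure X) : Measure (Fin 2 → ℝ) :=
  (avgPair μ₁ μ₂).map fun x j =>
    ((if j = 0 then μ₁ else μ₂).rnDeriv (avgPair μ₁ μ₂) x).toReal

section Algebra

variable {ι : Type*} [Fintype ι]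

/-- Testing against polynomials the functional attached to the coefficients
`α ^ (n + 2) / (n + 2) + β ^ 2 * α ^ n`. -/
lemma sum_eval_eq_of_coeff_eq {α β α' β' : ι → ℝ}
    (h : ∀ n : ℕ, ∑ i, (α i ^ (n + 2) / (n + 2) + β i ^ 2 * α i ^ n) =
      ∑ i, (α' i ^ (n + 2) / (n + 2) + β' i ^ 2 * α' i ^ n)) (Q : Polynomial ℝ) :
    ∑ i, (α i ^ 2 * Q.eval (α i) +
        β i ^ 2 * (α i * Q.derivative.eval (α i) + 2 * Q.eval (α i))) =
      ∑ i, (α' i ^ 2 * Q.eval (α' i) +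
        β' i ^ 2 * (α' i * Q.derivative.eval (α' i) + 2 * Q.eval (α' i))) := by
  induction Q using Polynomial.induction_on' with
  | add p q hp hq =>
    have key (a b : ι → ℝ) : ∑ i, (a i ^ 2 * (p + q).eval (a i) +
        b i ^ 2 * (a i * (p + q).derivative.eval (a i) + 2 * (p + q).eval (a i))) =
      ∑ i, (a i ^ 2 * p.eval (a i) +
        b i ^ 2 * (a i * p.derivative.eval (a i) + 2 * p.eval (a i))) +
      ∑ i, (a i ^ 2 * q.eval (a i) +
        b i ^ 2 * (a i * q.derivative.eval (a i) + 2 * q.eval (a i))) := by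
      rw [← Finset.sum_add_distrib]
      refine Finset.sum_congr rfl fun i _ => ?_
      simp only [Polynomial.eval_add, Polynomial.derivative_add]
      ring
    rw [key, key, hp, hq]
  | monomial n r =>
    have key (a b : ι → ℝ) : ∑ i, (a i ^ 2 * (Polynomial.monomial n r).eval (a i) +
        b i ^ 2 * (a i * (Polynomial.monomial n r).derivative.eval (a i) +
          2 * (Polynomial.monomial n r).eval (a i))) =
        r * (n + 2) * ∑ i, (a i ^ (n + 2) / (n + 2) + b i ^ 2 * a i ^ n) := by
      rw [Finset.mul_sum]
      refine Finset.sum_congr rfl fun i _ => ?_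
      have : (n : ℝ) + 2 ≠ 0 := by positivity
      simp only [Polynomial.eval_monomial, Polynomial.derivative_monomial]
      rcases n with _ | n
      · simp
        ring
      · field_simp
        simp only [Nat.cast_add, Nat.cast_one, Nat.add_sub_cancel]
        ring
    rw [key, key, h]

lemma sum_fiber_eq_of_coeff_eq {α β α' β' : ι → ℝ}
    (h : ∀ n : ℕ, ∑ i, (α i ^ (n + 2) / (n + 2) + β i ^ 2 * α i ^ n) =
      ∑ i, (α' i ^ (n + 2) / (n + 2) + β' i ^ 2 * α' i ^ n)) :
    (∀ c, ({i | α i = c} : Finset ι).card = ({i | α' i = c} : Finset ι).card) ∧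
      ∀ c, ∑ i with α i = c, β i ^ 2 = ∑ i with α' i = c, β' i ^ 2 := by
  classical
  have hQ := sum_eval_eq_of_coeff_eq h
  set s : Finset ℝ := Finset.univ.image α ∪ Finset.univ.image α' with hs
  have hα (i) : α i ∈ s := by simp [hs]
  have hα' (i) : α' i ∈ s := by simp [hs]
  let P (c : ℝ) : Polynomial ℝ := (∏ x ∈ s.erase c, (Polynomial.X - Polynomial.C x)) ^ 2
  have hPc (c : ℝ) : (P c).eval c ≠ 0 := by
    simp only [P, Polynomial.eval_pow, Polynomial.eval_prod]
    refine pow_ne_zero _ (Finset.prod_ne_zero_iff.2 fun x hx => ?_)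
    simpa [sub_eq_zero] using (Finset.ne_of_mem_erase hx).symm
  have hP0 (c x : ℝ) (hx : x ∈ s) (hxc : x ≠ c) :
      (∏ x ∈ s.erase c, (Polynomial.X - Polynomial.C x)).eval x = 0 := by
    rw [Polynomial.eval_prod]
    exact Finset.prod_eq_zero (Finset.mem_erase.2 ⟨hxc, hx⟩) (by simp)
  have key (c : ℝ) (R : Polynomial ℝ) (a b : ι → ℝ) (ha : ∀ i, a i ∈ s) :
      ∑ i, (a i ^ 2 * (P c * R).eval (a i) +
        b i ^ 2 * (a i * (P c * R).derivative.eval (a i) + 2 * (P c * R).eval (a i))) =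
      ({i | a i = c} : Finset ι).card * (c ^ 2 * (P c * R).eval c) +
      (∑ i with a i = c, b i ^ 2) *
        (c * (P c * R).derivative.eval c + 2 * (P c * R).eval c) := by
    rw [← nsmul_eq_mul, ← Finset.sum_const, Finset.sum_mul, ← Finset.sum_add_distrib,
      Finset.sum_filter]
    refine Finset.sum_congr rfl fun i _ => ?_
    split_ifs with hi
    · rw [hi]
    · have := hP0 c (a i) (ha i) hi
      simp [P, this, Polynomial.derivative_mul, Polynomial.derivative_pow]
  have hB (c : ℝ) : ∑ i with α i = c, β i ^ 2 = ∑ i with α' i = c, β' i ^ 2 := by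
    rcases eq_or_ne c 0 with rfl | hc
    · have := hQ (P 0 * 1)
      rw [key 0 1 α β hα, key 0 1 α' β' hα'] at this
      simpa [hPc] using this
    · have := hQ (P c * (Polynomial.X - Polynomial.C c))
      rw [key c _ α β hα, key c _ α' β' hα'] at this
      simpa [hPc, hc, Polynomial.derivative_mul] using this
  have hC (c : ℝ) (hc : c ≠ 0) :
      ({i | α i = c} : Finset ι).card = ({i | α' i = c} : Finset ι).card := by
    have := hQ (P c * 1)
    rw [key c 1 α β hα, key c 1 α' β' hα', hB c] at this
    simpa [hPc, hc] using this
  refine ⟨fun c => ?_, hB⟩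
  rcases ne_or_eq c 0 with hc | rfl
  · exact hC c hc
  · have e1 := Finset.card_eq_sum_card_fiberwise (s := Finset.univ) (t := insert 0 s) (f := α)
      fun i _ => by simp [hα i]
    have e2 := Finset.card_eq_sum_card_fiberwise (s := Finset.univ) (t := insert 0 s) (f := α')
      fun i _ => by simp [hα' i]
    rw [← Finset.add_sum_erase _ _ (Finset.mem_insert_self 0 s)] at e1 e2
    have e3 : ∑ c ∈ (insert 0 s).erase 0, ({i | α i = c} : Finset ι).card =
        ∑ c ∈ (insert 0 s).erase 0, ({i | α' i = c} : Finset ι).card :=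
      Finset.sum_congr rfl fun c hc => hC c (Finset.ne_of_mem_erase hc)
    omega

/-- A blockwise Householder reflection: if `a` and `a'` have the same norm on every level set of
`d`, some orthogonal matrix commuting with `diagonal d` sends `a` to `a'`. -/
lemma exists_orthogonal_of_sum_sq_fiber_eq [DecidableEq ι] {d a a' : ι → ℝ}
    (h : ∀ c, ∑ i with d i = c, a i ^ 2 = ∑ i with d i = c, a' i ^ 2) :
    ∃ U : Matrix ι ι ℝ, U * Uᵀ = 1 ∧ U * diagonal d * Uᵀ = diagonal d ∧ U *ᵥ a = a' := by
  set v : ι → ℝ := fun i => a i - a' i with hv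
  set V : ℝ → ℝ := fun c => ∑ k with d k = c, v k ^ 2
  set P : Matrix ι ι ℝ := of fun i j => if d i = d j then 2 * v i * v j / V (d i) else 0 with hP
  have hv0 (i : ι) (hi : V (d i) = 0) : v i = 0 := by
    have := (Finset.sum_eq_zero_iff_of_nonneg fun k _ => sq_nonneg (v k)).1 hi i (by simp)
    simpa using this
  have hPt : Pᵀ = P := by
    ext i j
    simp only [hP, transpose_apply, of_apply, eq_comm (a := d j)]
    split_ifs with hij
    · rw [hij]; ring
    · rfl
  have hPP : P * P = 2 • P := by
    ext i j
    simp only [hP, mul_apply, of_apply, Matrix.smul_apply]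
    by_cases hij : d i = d j
    · have : ∀ k, ((if d i = d k then 2 * v i * v k / V (d i) else 0) *
          if d k = d j then 2 * v k * v j / V (d k) else 0) =
          4 * v i * v j / V (d i) ^ 2 * if d k = d i then v k ^ 2 else 0 := by
        intro k
        by_cases hk : d i = d k
        · rw [if_pos hk, if_pos (hk ▸ hij), if_pos hk.symm, ← hk]; ring
        · rw [if_neg hk, if_neg (Ne.symm hk)]; ring
      rw [Finset.sum_congr rfl fun k _ => this k, ← Finset.mul_sum, ← Finset.sum_filter, if_pos hij]
      change _ * V (d i) = _
      by_cases h0 : V (d i) = 0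
      · simp [h0]
      · rw [nsmul_eq_mul, Nat.cast_ofNat]
        field_simp
        ring
    · rw [if_neg hij, smul_zero]
      refine Finset.sum_eq_zero fun k _ => ?_
      by_cases hk : d i = d k
      · rw [if_neg fun hkj => hij (hk.trans hkj), mul_zero]
      · rw [if_neg hk, zero_mul]
  have hPD : P * diagonal d = diagonal d * P := by
    ext i j
    simp only [hP, mul_diagonal, diagonal_mul, of_apply]
    split_ifs with hij
    · rw [hij]; ring
    · ring
  have hUU : (1 - P) * (1 - P) = 1 := by
    have : (1 - P) * (1 - P) = 1 - 2 • P + P * P := by noncomm_ring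
    rw [this, hPP]; simp
  have hUt : (1 - P)ᵀ = 1 - P := by rw [transpose_sub, transpose_one, hPt]
  refine ⟨1 - P, by rw [hUt, hUU], ?_, ?_⟩
  · have : (1 - P) * diagonal d = diagonal d * (1 - P) := by
      rw [sub_mul, mul_sub, hPD, one_mul, mul_one]
    rw [hUt, this, mul_assoc, hUU, mul_one]
  · ext i
    have hsum : ∑ k with d k = d i, v k * a k = V (d i) / 2 := by
      have : V (d i) = 2 * ∑ k with d k = d i, v k * a k +
          (∑ k with d k = d i, a' k ^ 2 - ∑ k with d k = d i, a k ^ 2) := by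
        rw [Finset.mul_sum, ← Finset.sum_sub_distrib, ← Finset.sum_add_distrib]
        exact Finset.sum_congr rfl fun k _ => by simp only [hv]; ring
      rw [this, h]; ring
    have hPa : (P *ᵥ a) i = 2 * v i / V (d i) * (V (d i) / 2) := by
      rw [← hsum, Finset.mul_sum, Finset.sum_filter]
      refine Finset.sum_congr rfl fun k _ => ?_
      simp only [hP, of_apply, eq_comm (a := d k)]
      split_ifs <;> ring
    rw [sub_mulVec, one_mulVec, Pi.sub_apply, hPa]
    by_cases h0 : V (d i) = 0
    · have := hv0 i h0
      simp only [hv] at this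
      simp [h0]; linarith
    · have : 2 * v i / V (d i) * (V (d i) / 2) = v i := by field_simp
      rw [this]; simp [hv]

lemma exists_orthogonal_of_fiber_eq [DecidableEq ι] {d a d' a' : ι → ℝ}
    (hd : ∀ c, ({i | d i = c} : Finset ι).card = ({i | d' i = c} : Finset ι).card)
    (ha : ∀ c, ∑ i with d i = c, a i ^ 2 = ∑ i with d' i = c, a' i ^ 2) :
    ∃ U : Matrix ι ι ℝ, U * Uᵀ = 1 ∧ U * diagonal d * Uᵀ = diagonal d' ∧ U *ᵥ a = a' := by
  have e (c : ℝ) : Nonempty ({i // d i = c} ≃ {i // d' i = c}) := by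
    refine Fintype.card_eq.1 ?_
    simpa [Fintype.card_subtype] using hd c
  let σ : ι ≃ ι := Equiv.ofFiberEquiv fun c => (e c).some
  have hσ (i : ι) : d' (σ i) = d i := Equiv.ofFiberEquiv_map _ i
  obtain ⟨U, h1, h2, h3⟩ := exists_orthogonal_of_sum_sq_fiber_eq (d := d) (a := a) (a' := a' ∘ σ)
    fun c => by
      rw [ha, Finset.sum_filter, Finset.sum_filter, ← Equiv.sum_comp σ]
      simp [hσ]
  have hd' : d ∘ σ.symm = d' := by
    ext i
    simp [← hσ]
  refine ⟨U.submatrix σ.symm id, ?_, ?_, ?_⟩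
  · rw [transpose_submatrix, ← submatrix_mul _ _ _ _ _ Function.bijective_id, h1, submatrix_one_equiv]
  · have : U.submatrix σ.symm id * diagonal d = (U * diagonal d).submatrix σ.symm id := by
      ext i j; simp
    rw [this, transpose_submatrix, ← submatrix_mul _ _ _ _ _ Function.bijective_id, h2,
      submatrix_diagonal_equiv, hd']
  · ext i
    have := congrFun h3 (σ.symm i)
    simpa [mulVec, dotProduct] using this

end Algebra

section PairLaw

variable {X Y : Type*} [MeasurableSpace X] [MeasurableSpace Y]

lemma mPair_map {f : X → Y} (hf : MeasurableEmbedding f) (μ₁ μ₂ : Measure X)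
    [SigmaFinite μ₁] [SigmaFinite μ₂] [SigmaFinite (avgPair μ₁ μ₂)] :
    mPair (μ₁.map f) (μ₂.map f) = mPair μ₁ μ₂ := by
  have havg : avgPair (μ₁.map f) (μ₂.map f) = (avgPair μ₁ μ₂).map f := by
    rw [avgPair, avgPair, Measure.map_smul, Measure.map_add _ _ hf.measurable]
  have hif (j : Fin 2) : (if j = 0 then μ₁.map f else μ₂.map f) =
      (if j = 0 then μ₁ else μ₂).map f := by split_ifs <;> rfl
  have hsf (j : Fin 2) : SigmaFinite (if j = 0 then μ₁ else μ₂) := by split_ifs <;> infer_instance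
  simp only [mPair, havg, hif]
  rw [Measure.map_map
    (measurable_pi_iff.2 fun j => (Measure.measurable_rnDeriv _ _).ennreal_toReal) hf.measurable]
  refine Measure.map_congr ?_
  have hae : ∀ᵐ x ∂avgPair μ₁ μ₂, ∀ j : Fin 2,
      ((if j = 0 then μ₁ else μ₂).map f).rnDeriv ((avgPair μ₁ μ₂).map f) (f x) =
        (if j = 0 then μ₁ else μ₂).rnDeriv (avgPair μ₁ μ₂) x :=
    ae_all_iff.2 fun j => hf.rnDeriv_map _ _
  filter_upwards [hae] with x hx
  funext j
  simp only [Function.comp_apply, hx j]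

variable {μ : Measure X} {f₁ f₂ : X → ℝ}

lemma avgPair_withDensity (h₁ : Measurable f₁) (p₁ : ∀ x, 0 < f₁ x) (p₂ : ∀ x, 0 < f₂ x) :
    avgPair (μ.withDensity fun x => ENNReal.ofReal (f₁ x))
      (μ.withDensity fun x => ENNReal.ofReal (f₂ x)) =
      μ.withDensity fun x => ENNReal.ofReal ((f₁ x + f₂ x) / 2) := by
  rw [avgPair, ← withDensity_add_left (by fun_prop), ← withDensity_smul' _ _ (by simp)]
  congr 1
  funext x
  have : (2 : ℝ≥0∞)⁻¹ = ENNReal.ofReal 2⁻¹ := by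
    rw [ENNReal.ofReal_inv_of_pos two_pos, ENNReal.ofReal_ofNat]
  simp only [Pi.smul_apply, Pi.add_apply, smul_eq_mul]
  rw [← ENNReal.ofReal_add (p₁ x).le (p₂ x).le, this, ← ENNReal.ofReal_mul (by norm_num)]
  ring_nf

/-- Hellinger integrals of a pair of measures with positive densities are determined by the law of
the pair of Radon–Nikodym derivatives. -/
lemma integral_rpow_mPair [SigmaFinite μ] (h₁ : Measurable f₁) (h₂ : Measurable f₂)
    (p₁ : ∀ x, 0 < f₁ x) (p₂ : ∀ x, 0 < f₂ x) (t : ℝ) :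
    ∫ y, y 0 ^ (1 - t) * y 1 ^ t ∂mPair (μ.withDensity fun x => ENNReal.ofReal (f₁ x))
      (μ.withDensity fun x => ENNReal.ofReal (f₂ x)) = ∫ x, f₁ x ^ (1 - t) * f₂ x ^ t ∂μ := by
  have hrn {f : X → ℝ} (hf : Measurable f) (p : ∀ x, 0 < f x) :
      (μ.withDensity fun x => ENNReal.ofReal (f x)).rnDeriv
        (μ.withDensity fun x => ENNReal.ofReal ((f₁ x + f₂ x) / 2))
        =ᵐ[μ.withDensity fun x => ENNReal.ofReal ((f₁ x + f₂ x) / 2)]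
        fun x => ENNReal.ofReal (f x / ((f₁ x + f₂ x) / 2)) := by
    have : (μ.withDensity fun x => ENNReal.ofReal (f x)) =
        (μ.withDensity fun x => ENNReal.ofReal ((f₁ x + f₂ x) / 2)).withDensity
          fun x => ENNReal.ofReal (f x / ((f₁ x + f₂ x) / 2)) := by
      rw [← withDensity_mul _ (by fun_prop) (by fun_prop)]
      congr 1
      funext x
      have := p₁ x
      have := p₂ x
      rw [Pi.mul_apply, ← ENNReal.ofReal_mul (by positivity)]
      congr 1
      field_simp
    rw [this]
    exact Measure.rnDeriv_withDensity _ (by fun_prop)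
  rw [mPair, avgPair_withDensity h₁ p₁ p₂, integral_map
    (measurable_pi_iff.2 fun j => (Measure.measurable_rnDeriv _ _).ennreal_toReal).aemeasurable
    (by fun_prop)]
  simp only [if_true, one_ne_zero, if_false]
  have : (fun x => ((μ.withDensity fun x => ENNReal.ofReal (f₁ x)).rnDeriv
        (μ.withDensity fun x => ENNReal.ofReal ((f₁ x + f₂ x) / 2)) x).toReal ^ (1 - t) *
      ((μ.withDensity fun x => ENNReal.ofReal (f₂ x)).rnDeriv
        (μ.withDensity fun x => ENNReal.ofReal ((f₁ x + f₂ x) / 2)) x).toReal ^ t)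
      =ᵐ[μ.withDensity fun x => ENNReal.ofReal ((f₁ x + f₂ x) / 2)]
      fun x => f₁ x ^ (1 - t) * f₂ x ^ t / ((f₁ x + f₂ x) / 2) := by
    filter_upwards [hrn h₁ p₁, hrn h₂ p₂] with x hx₁ hx₂
    have := p₁ x
    have := p₂ x
    rw [hx₁, hx₂, ENNReal.toReal_ofReal (by positivity), ENNReal.toReal_ofReal (by positivity),
      Real.div_rpow (p₁ x).le (by positivity), Real.div_rpow (p₂ x).le (by positivity),
      div_mul_div_comm, ← Real.rpow_add (by positivity), sub_add_cancel, Real.rpow_one]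
  rw [integral_congr_ae this, integral_withDensity_eq_integral_toReal_smul (by fun_prop)
    (by simp)]
  refine integral_congr_ae (ae_of_all _ fun x => ?_)
  have := p₁ x
  have := p₂ x
  simp only [smul_eq_mul]
  rw [ENNReal.toReal_ofReal (by positivity)]
  field_simp

end PairLaw

section Gaussian

variable {N : ℕ}

lemma measurable_gaussianDensity (b : Fin N → ℝ) (S : Matrix (Fin N) (Fin N) ℝ) :
    Measurable (gaussianDensity b S) := by
  unfold gaussianDensity
  have : Continuous fun x : Fin N → ℝ => (x - b) ⬝ᵥ (S⁻¹ *ᵥ (x - b)) := by fun_prop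
  fun_prop

lemma gaussianDensity_pos (b : Fin N → ℝ) {S : Matrix (Fin N) (Fin N) ℝ} (hS : S.PosDef)
    (x : Fin N → ℝ) : 0 < gaussianDensity b S x := by
  have := hS.det_pos
  unfold gaussianDensity
  positivity

instance sigmaFinite_gaussianMeasure (b : Fin N → ℝ) (S : Matrix (Fin N) (Fin N) ℝ) :
    SigmaFinite (gaussianMeasure b S) := by
  unfold gaussianMeasure
  infer_instance

lemma sigmaFinite_avgPair_gaussianMeasure (b₁ b₂ : Fin N → ℝ) {S₁ S₂ : Matrix (Fin N) (Fin N) ℝ}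
    (h₁ : S₁.PosDef) (h₂ : S₂.PosDef) :
    SigmaFinite (avgPair (gaussianMeasure b₁ S₁) (gaussianMeasure b₂ S₂)) := by
  unfold gaussianMeasure
  rw [avgPair_withDensity (measurable_gaussianDensity b₁ S₁) (gaussianDensity_pos b₁ h₁)
    (gaussianDensity_pos b₂ h₂)]
  infer_instance

lemma measurableEmbedding_affine {A : Matrix (Fin N) (Fin N) ℝ} (hA : IsUnit A.det)
    (b : Fin N → ℝ) : MeasurableEmbedding fun x => A *ᵥ x + b := by
  refine Continuous.measurableEmbedding (by fun_prop) fun x y hxy => ?_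
  exact mulVec_injective_iff_isUnit.2 ((isUnit_iff_isUnit_det A).2 hA) (add_right_cancel hxy)

lemma map_affine_volume {A : Matrix (Fin N) (Fin N) ℝ} (hA : IsUnit A.det) (b : Fin N → ℝ) :
    (volume : Measure (Fin N → ℝ)).map (fun x => A *ᵥ x + b) =
      ENNReal.ofReal |A.det⁻¹| • volume := by
  have : (fun x => A *ᵥ x + b) = (fun x => x + b) ∘ (toLin' A) := by
    ext x; simp
  rw [this, ← Measure.map_map (by fun_prop) (LinearMap.continuous_of_finiteDimensional _).measurable,
    Real.map_matrix_volume_pi_eq_smul_volume_pi hA.ne_zero, Measure.map_smul,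
    map_add_right_eq_self]

lemma gaussianDensity_eq_affine {A S : Matrix (Fin N) (Fin N) ℝ} (hA : IsUnit A.det)
    (hS : S.PosDef) (m b x : Fin N → ℝ) :
    gaussianDensity m S x =
      |A.det| * gaussianDensity (A *ᵥ m + b) (A * S * Aᵀ) (A *ᵥ x + b) := by
  have hdet := hS.det_pos
  have hA0 : 0 < |A.det| := abs_pos.2 hA.ne_zero
  have hsq : √((2 * Real.pi) ^ N * (A * S * Aᵀ).det) =
      |A.det| * √((2 * Real.pi) ^ N * S.det) := by
    rw [det_mul, det_mul, det_transpose,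
      show (2 * Real.pi) ^ N * (A.det * S.det * A.det) =
        A.det ^ 2 * ((2 * Real.pi) ^ N * S.det) by ring,
      Real.sqrt_mul (sq_nonneg _), Real.sqrt_sq_eq_abs]
  have hquad : (A *ᵥ x + b - (A *ᵥ m + b)) ⬝ᵥ ((A * S * Aᵀ)⁻¹ *ᵥ (A *ᵥ x + b - (A *ᵥ m + b))) =
      (x - m) ⬝ᵥ (S⁻¹ *ᵥ (x - m)) := by
    have hAt : IsUnit Aᵀ.det := by rwa [det_transpose]
    rw [add_sub_add_right_eq_sub, ← mulVec_sub, mulVec_mulVec, Matrix.mul_inv_rev, Matrix.mul_inv_rev,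
      mul_assoc, mul_assoc, nonsing_inv_mul _ hA, mul_one, ← mulVec_mulVec, dotProduct_mulVec,
      ← mulVec_transpose, mulVec_mulVec, transpose_nonsing_inv, transpose_transpose,
      nonsing_inv_mul _ hA, one_mulVec]
  unfold gaussianDensity
  rw [hquad, hsq, mul_inv]
  field_simp

lemma gaussianMeasure_map_affine {A S : Matrix (Fin N) (Fin N) ℝ} (hA : IsUnit A.det)
    (hS : S.PosDef) (m b : Fin N → ℝ) :
    (gaussianMeasure m S).map (fun x => A *ᵥ x + b) =
      gaussianMeasure (A *ᵥ m + b) (A * S * Aᵀ) := by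
  have hT := measurableEmbedding_affine hA b
  have hg := measurable_gaussianDensity (A *ᵥ m + b) (A * S * Aᵀ)
  ext s hs
  have hfun (x : Fin N → ℝ) : ENNReal.ofReal (gaussianDensity m S x) =
      (fun y => ENNReal.ofReal |A.det| *
        ENNReal.ofReal (gaussianDensity (A *ᵥ m + b) (A * S * Aᵀ) y)) (A *ᵥ x + b) := by
    rw [gaussianDensity_eq_affine hA hS m b, ENNReal.ofReal_mul (abs_nonneg _)]
  rw [hT.map_apply, gaussianMeasure, withDensity_apply _ (hT.measurable hs),
    gaussianMeasure, withDensity_apply _ hs, lintegral_congr hfun,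
    ← setLIntegral_map (f := fun y => ENNReal.ofReal |A.det| *
      ENNReal.ofReal (gaussianDensity (A *ᵥ m + b) (A * S * Aᵀ) y))
      hs (by fun_prop) hT.measurable, map_affine_volume hA,
    Measure.restrict_smul, lintegral_smul_measure, lintegral_const_mul _ (by fun_prop),
    smul_eq_mul, ← mul_assoc, ← ENNReal.ofReal_mul (abs_nonneg _), abs_inv,
    inv_mul_cancel₀ (abs_ne_zero.2 hA.ne_zero), ENNReal.ofReal_one, one_mul]

lemma mPair_gaussianMeasure_map_affine {A S₁ S₂ : Matrix (Fin N) (Fin N) ℝ} (hA : IsUnit A.det)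
    (h₁ : S₁.PosDef) (h₂ : S₂.PosDef) (m₁ m₂ b : Fin N → ℝ) :
    mPair ((gaussianMeasure m₁ S₁).map (fun x => A *ᵥ x + b))
      ((gaussianMeasure m₂ S₂).map (fun x => A *ᵥ x + b)) =
      mPair (gaussianMeasure m₁ S₁) (gaussianMeasure m₂ S₂) :=
  have := sigmaFinite_avgPair_gaussianMeasure m₁ m₂ h₁ h₂
  mPair_map (measurableEmbedding_affine hA b) _ _

/-- Simultaneous diagonalization of a pair of nondegenerate Gaussian laws. -/
lemma exists_simultaneous_diagonalization {S₁ S₂ : Matrix (Fin N) (Fin N) ℝ} (h₁ : S₁.PosDef)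
    (h₂ : S₂.PosDef) : ∃ (A : Matrix (Fin N) (Fin N) ℝ) (d : Fin N → ℝ), IsUnit A.det ∧
      (∀ i, 0 < d i) ∧ A * S₁ * Aᵀ = 1 ∧ A * S₂ * Aᵀ = diagonal d := by
  have hspec {S : Matrix (Fin N) (Fin N) ℝ} (hS : S.PosDef) :
      ∃ (U : Matrix (Fin N) (Fin N) ℝ) (d : Fin N → ℝ), IsUnit U.det ∧ (∀ i, 0 < d i) ∧
        U * Uᵀ = 1 ∧ U * S * Uᵀ = diagonal d := by
    set V := hS.isHermitian.eigenvectorUnitary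
    have hV : (V : Matrix (Fin N) (Fin N) ℝ)ᵀ * V = 1 := Unitary.coe_star_mul_self V
    refine ⟨(V : Matrix (Fin N) (Fin N) ℝ)ᵀ, hS.isHermitian.eigenvalues, ?_, hS.eigenvalues_pos,
      by rw [transpose_transpose, hV], ?_⟩
    · exact (isUnit_iff_isUnit_det _).1 (IsUnit.of_mul_eq_one _ hV)
    · have := hS.isHermitian.conjStarAlgAut_star_eigenvectorUnitary
      rw [Unitary.conjStarAlgAut_star_apply] at this
      rw [transpose_transpose]
      exact this
  obtain ⟨U, d, hU, hd, -, hUS⟩ := hspec h₁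
  set B : Matrix (Fin N) (Fin N) ℝ := diagonal (fun i => (√(d i))⁻¹) * U with hB
  have hBu : IsUnit B.det := by
    rw [hB, det_mul, det_diagonal]
    refine IsUnit.mul (Finset.prod_ne_zero_iff.2 fun i _ => ?_).isUnit hU
    have := hd i
    positivity
  have hB1 : B * S₁ * Bᵀ = 1 := by
    rw [hB, transpose_mul, diagonal_transpose,
      show diagonal (fun i => (√(d i))⁻¹) * U * S₁ * (Uᵀ * diagonal fun i => (√(d i))⁻¹) =
        diagonal (fun i => (√(d i))⁻¹) * (U * S₁ * Uᵀ) * diagonal fun i => (√(d i))⁻¹ by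
          simp only [mul_assoc],
      hUS, diagonal_mul_diagonal, diagonal_mul_diagonal, ← diagonal_one]
    congr 1
    funext i
    have := Real.sqrt_pos.2 (hd i)
    field_simp
    exact (Real.sq_sqrt (hd i).le).symm
  have hB2 : (B * S₂ * Bᵀ).PosDef :=
    (IsUnit.posDef_star_right_conjugate_iff ((isUnit_iff_isUnit_det B).2 hBu)).2 h₂
  obtain ⟨V, e, hV, he, hVV, hVS⟩ := hspec hB2
  refine ⟨V * B, e, by rw [det_mul]; exact hV.mul hBu, he, ?_, ?_⟩
  · rw [transpose_mul, show V * B * S₁ * (Bᵀ * Vᵀ) = V * (B * S₁ * Bᵀ) * Vᵀ by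
      simp only [mul_assoc], hB1, mul_one, hVV]
  · rw [transpose_mul, show V * B * S₂ * (Bᵀ * Vᵀ) = V * (B * S₂ * Bᵀ) * Vᵀ by
      simp only [mul_assoc], hVS]

lemma gaussianDensity_diagonal (a : Fin N → ℝ) {d : Fin N → ℝ} (hd : ∀ i, 0 < d i)
    (x : Fin N → ℝ) : gaussianDensity a (diagonal d) x =
      Real.exp (∑ i, -(1 / 2) * (Real.log (2 * Real.pi * d i) + (x i - a i) ^ 2 / d i)) := by
  have hdet : (2 * Real.pi) ^ N * (diagonal d).det = ∏ i, 2 * Real.pi * d i := by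
    rw [det_diagonal, Finset.prod_mul_distrib]; simp
  have hinv : (diagonal d)⁻¹ = diagonal fun i => (d i)⁻¹ := by
    refine inv_eq_right_inv ?_
    rw [diagonal_mul_diagonal, ← diagonal_one]
    congr 1
    funext i
    exact mul_inv_cancel₀ (hd i).ne'
  have hpos : 0 < ∏ i, 2 * Real.pi * d i :=
    Finset.prod_pos fun i _ => mul_pos (by positivity) (hd i)
  have hlog : Real.log (∏ i, 2 * Real.pi * d i) = ∑ i, Real.log (2 * Real.pi * d i) :=
    Real.log_prod fun i _ => (mul_pos (by positivity) (hd i)).ne'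
  have hsq : (√(∏ i, 2 * Real.pi * d i))⁻¹ =
      Real.exp (-(1 / 2) * ∑ i, Real.log (2 * Real.pi * d i)) := by
    rw [← hlog, ← Real.exp_log (Real.sqrt_pos.2 hpos), ← Real.exp_neg, Real.log_sqrt hpos.le]
    congr 1
    ring
  rw [gaussianDensity, hdet, hsq, hinv, ← Real.exp_add]
  congr 1
  rw [← mul_add, ← Finset.mul_sum, Finset.sum_add_distrib]
  congr 2
  refine Finset.sum_congr rfl fun i _ => ?_
  rw [mulVec_diagonal]
  simp only [Pi.sub_apply]
  ring

lemma integral_exp_gaussian_mixture {a d t : ℝ} (hd : 0 < d) (ht : 0 < 1 - t * (1 - d⁻¹)) :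
    ∫ x : ℝ, Real.exp ((1 - t) * (-(1 / 2) * (Real.log (2 * Real.pi * 1) + (x - 0) ^ 2 / 1)) +
      t * (-(1 / 2) * (Real.log (2 * Real.pi * d) + (x - a) ^ 2 / d))) =
    Real.exp (-(1 / 2) * (t * (Real.log d + a ^ 2 / d) + Real.log (1 - t * (1 - d⁻¹)) -
      t ^ 2 * (a / d) ^ 2 / (1 - t * (1 - d⁻¹)))) := by
  set p := 1 - t * (1 - d⁻¹) with hp
  have hfun (x : ℝ) : Real.exp ((1 - t) * (-(1 / 2) * (Real.log (2 * Real.pi * 1) +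
      (x - 0) ^ 2 / 1)) + t * (-(1 / 2) * (Real.log (2 * Real.pi * d) + (x - a) ^ 2 / d))) =
      Real.exp (-(1 / 2) * (Real.log (2 * Real.pi) + t * (Real.log d + a ^ 2 / d) -
        t ^ 2 * (a / d) ^ 2 / p)) * Real.exp (-(p / 2) * (x - t * (a / d) / p) ^ 2) := by
    rw [← Real.exp_add, Real.log_mul (by positivity) hd.ne', mul_one]
    congr 1
    have e : (p / 2) * (x - t * (a / d) / p) ^ 2 =
        p / 2 * x ^ 2 - t * (a / d) * x + t ^ 2 * (a / d) ^ 2 / p / 2 := by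
      field_simp
      ring
    rw [neg_mul (p / 2), e, hp]
    ring
  simp_rw [hfun]
  rw [integral_const_mul, integral_sub_right_eq_self (fun x => Real.exp (-(p / 2) * x ^ 2)),
    integral_gaussian, show Real.pi / (p / 2) = 2 * Real.pi / p by field_simp,
    ← Real.exp_log (Real.sqrt_pos.2 (show 0 < 2 * Real.pi / p by positivity)),
    Real.log_sqrt (by positivity), Real.log_div (by positivity) ht.ne', ← Real.exp_add]
  congr 1
  ring

lemma integral_gaussianDensity_rpow {a d : Fin N → ℝ} (hd : ∀ i, 0 < d i) {t : ℝ}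
    (ht : ∀ i, 0 < 1 - t * (1 - (d i)⁻¹)) :
    ∫ x, gaussianDensity 0 1 x ^ (1 - t) * gaussianDensity a (diagonal d) x ^ t =
    Real.exp (-(1 / 2) * ∑ i, (t * (Real.log (d i) + a i ^ 2 / d i) +
      Real.log (1 - t * (1 - (d i)⁻¹)) -
      t ^ 2 * (a i / d i) ^ 2 / (1 - t * (1 - (d i)⁻¹)))) := by
  have hfun (x : Fin N → ℝ) :
      gaussianDensity 0 1 x ^ (1 - t) * gaussianDensity a (diagonal d) x ^ t =
      ∏ i, Real.exp ((1 - t) * (-(1 / 2) * (Real.log (2 * Real.pi * 1) + (x i - 0) ^ 2 / 1)) +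
        t * (-(1 / 2) * (Real.log (2 * Real.pi * d i) + (x i - a i) ^ 2 / d i))) := by
    rw [← diagonal_one, gaussianDensity_diagonal 0 (fun _ => one_pos),
      gaussianDensity_diagonal a hd, ← Real.exp_mul, ← Real.exp_mul, ← Real.exp_add,
      ← Real.exp_sum, Finset.sum_mul, Finset.sum_mul, ← Finset.sum_add_distrib]
    congr 1
    refine Finset.sum_congr rfl fun i _ => ?_
    simp only [Pi.zero_apply]
    ring
  simp_rw [hfun]
  rw [integral_fintype_prod_volume_eq_prod (fun i (y : ℝ) =>
    Real.exp ((1 - t) * (-(1 / 2) * (Real.log (2 * Real.pi * 1) + (y - 0) ^ 2 / 1)) +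
        t * (-(1 / 2) * (Real.log (2 * Real.pi * d i) + (y - a i) ^ 2 / d i)))),
    Finset.mul_sum, Real.exp_sum]
  exact Finset.prod_congr rfl fun i _ => integral_exp_gaussian_mixture (hd i) (ht i)

end Gaussian

section PowerSeries

/-- Taylor coefficients at `0` of
`t ↦ t * κ + log (1 - t * α) - t ^ 2 * β ^ 2 / (1 - t * α)`. -/
def logHellingerCoeff (κ α β : ℝ) : ℕ → ℝ
  | 0 => 0
  | 1 => κ - α
  | n + 2 => -(α ^ (n + 2) / (n + 2) + β ^ 2 * α ^ n)

lemma hasSum_logHellingerCoeff (κ α β : ℝ) {t : ℝ} (ht : |t * α| < 1) :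
    HasSum (fun n => t ^ n * logHellingerCoeff κ α β n)
      (t * κ + Real.log (1 - t * α) - t ^ 2 * β ^ 2 / (1 - t * α)) := by
  have h1 := (hasSum_nat_add_iff' 1).2 (Real.hasSum_pow_div_log_of_abs_lt_one ht)
  have h2 := (hasSum_geometric_of_abs_lt_one ht).mul_left (t ^ 2 * β ^ 2)
  rw [← hasSum_nat_add_iff' 2]
  convert! (h1.add h2).neg using 1
  · funext n
    simp only [logHellingerCoeff]
    push_cast
    rw [mul_pow, mul_pow]
    ring
  · simp [Finset.sum_range_succ, logHellingerCoeff]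
    ring

variable {ι : Type*} [Fintype ι]

lemma coeff_eq_of_eventually_eq {κ α β κ' α' β' : ι → ℝ}
    (h : ∀ᶠ t in nhds (0 : ℝ),
      ∑ i, (t * κ i + Real.log (1 - t * α i) - t ^ 2 * β i ^ 2 / (1 - t * α i)) =
      ∑ i, (t * κ' i + Real.log (1 - t * α' i) - t ^ 2 * β' i ^ 2 / (1 - t * α' i))) (n : ℕ) :
    ∑ i, (α i ^ (n + 2) / (n + 2) + β i ^ 2 * α i ^ n) =
      ∑ i, (α' i ^ (n + 2) / (n + 2) + β' i ^ 2 * α' i ^ n) := by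
  have key (κ α β : ι → ℝ) : HasFPowerSeriesAt
      (fun t : ℝ => ∑ i, (t * κ i + Real.log (1 - t * α i) - t ^ 2 * β i ^ 2 / (1 - t * α i)))
      (FormalMultilinearSeries.ofScalars ℝ
        fun n => ∑ i, logHellingerCoeff (κ i) (α i) (β i) n) 0 := by
    rw [hasFPowerSeriesAt_iff]
    have hev : ∀ᶠ t in nhds (0 : ℝ), ∀ i, |t * α i| < 1 := by
      refine Filter.eventually_all.2 fun i => ?_
      have : Continuous fun t : ℝ => |t * α i| := by fun_prop
      exact this.continuousAt.eventually_lt_const (by simp)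
    filter_upwards [hev] with t ht
    simp only [zero_add, FormalMultilinearSeries.coeff_ofScalars, smul_eq_mul, Finset.mul_sum]
    exact hasSum_sum fun i _ => hasSum_logHellingerCoeff _ _ _ (ht i)
  have := congrArg (fun p => p.coeff (n + 2))
    (((key κ α β).congr h).eq_formalMultilinearSeries (key κ' α' β'))
  simp only [FormalMultilinearSeries.coeff_ofScalars, logHellingerCoeff, Finset.sum_neg_distrib,
    neg_inj] at this
  exact this

end PowerSeries

section Classification

variable {N : ℕ}

/-- For a pair formed by the standard Gaussian measure and a Gaussian measure with diagonal
covariance, the law of the derivatives determines the parameters up to an orthogonal change of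
coordinates. -/
lemma exists_orthogonal_of_mPair_eq {a d a' d' : Fin N → ℝ} (hd : ∀ i, 0 < d i)
    (hd' : ∀ i, 0 < d' i)
    (h : mPair (gaussianMeasure 0 1) (gaussianMeasure a (diagonal d)) =
      mPair (gaussianMeasure 0 1) (gaussianMeasure a' (diagonal d'))) :
    ∃ U : Matrix (Fin N) (Fin N) ℝ,
      U * Uᵀ = 1 ∧ U * diagonal d * Uᵀ = diagonal d' ∧ U *ᵥ a = a' := by
  have hev (e : Fin N → ℝ) : ∀ᶠ t in nhds (0 : ℝ), ∀ i, 0 < 1 - t * (1 - (e i)⁻¹) := by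
    refine Filter.eventually_all.2 fun i => ?_
    have : Continuous fun t : ℝ => 1 - t * (1 - (e i)⁻¹) := by fun_prop
    exact this.continuousAt.eventually_const_lt (by simp)
  have hint (b : Fin N → ℝ) {e : Fin N → ℝ} (he : ∀ i, 0 < e i) {t : ℝ}
      (ht : ∀ i, 0 < 1 - t * (1 - (e i)⁻¹)) :
      ∫ y, y 0 ^ (1 - t) * y 1 ^ t ∂mPair (gaussianMeasure 0 1) (gaussianMeasure b (diagonal e)) =
      Real.exp (-(1 / 2) * ∑ i, (t * (Real.log (e i) + b i ^ 2 / e i) +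
        Real.log (1 - t * (1 - (e i)⁻¹)) -
        t ^ 2 * (b i / e i) ^ 2 / (1 - t * (1 - (e i)⁻¹)))) := by
    rw [gaussianMeasure, gaussianMeasure, integral_rpow_mPair (measurable_gaussianDensity _ _)
      (measurable_gaussianDensity _ _) (gaussianDensity_pos _ PosDef.one)
      (gaussianDensity_pos _ (PosDef.diagonal he)), integral_gaussianDensity_rpow he ht]
  obtain ⟨hα, hβ⟩ := sum_fiber_eq_of_coeff_eq (coeff_eq_of_eventually_eq
    (κ := fun i => Real.log (d i) + a i ^ 2 / d i) (α := fun i => 1 - (d i)⁻¹)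
    (β := fun i => a i / d i) (κ' := fun i => Real.log (d' i) + a' i ^ 2 / d' i)
    (α' := fun i => 1 - (d' i)⁻¹) (β' := fun i => a' i / d' i) (by
      filter_upwards [hev d, hev d'] with t ht ht'
      have := hint a hd ht
      rw [h, hint a' hd' ht', Real.exp_eq_exp] at this
      linarith))
  obtain ⟨U, h1, h2, h3⟩ := exists_orthogonal_of_fiber_eq hα hβ
  have h1' : Uᵀ * U = 1 := mul_eq_one_comm.1 h1
  have hinv {e : Fin N → ℝ} (he : ∀ i, 0 < e i) :
      (diagonal e : Matrix (Fin N) (Fin N) ℝ) * diagonal (fun i => (e i)⁻¹) = 1 := by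
    rw [diagonal_mul_diagonal, ← diagonal_one]
    congr 1
    funext i
    exact mul_inv_cancel₀ (he i).ne'
  have hsub (e : Fin N → ℝ) : (diagonal fun i => 1 - (e i)⁻¹ : Matrix (Fin N) (Fin N) ℝ) =
      1 - diagonal fun i => (e i)⁻¹ := by
    rw [← diagonal_one, diagonal_sub]
  have hUinv : U * diagonal (fun i => (d i)⁻¹) * Uᵀ = diagonal fun i => (d' i)⁻¹ := by
    rw [hsub, hsub, mul_sub, sub_mul, mul_one, h1] at h2
    exact sub_right_injective h2
  have hU : U * diagonal d * Uᵀ = diagonal d' := by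
    have e1 : (U * diagonal (fun i => (d i)⁻¹) * Uᵀ) * (U * diagonal d * Uᵀ) = 1 := by
      rw [show (U * diagonal (fun i => (d i)⁻¹) * Uᵀ) * (U * diagonal d * Uᵀ) =
        U * (diagonal (fun i => (d i)⁻¹) * ((Uᵀ * U) * diagonal d)) * Uᵀ by simp only [mul_assoc],
        h1', one_mul, mul_eq_one_comm.1 (hinv hd), mul_one, h1]
    rw [hUinv] at e1
    calc U * diagonal d * Uᵀ
        = diagonal d' * (diagonal (fun i => (d' i)⁻¹)) * (U * diagonal d * Uᵀ) := by
          rw [hinv hd', one_mul]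
      _ = diagonal d' := by rw [mul_assoc, e1, mul_one]
  refine ⟨U, h1, hU, ?_⟩
  have hrec {e : Fin N → ℝ} (he : ∀ i, 0 < e i) (b : Fin N → ℝ) :
      diagonal e *ᵥ (fun i => b i / e i) = b := by
    ext i
    rw [mulVec_diagonal]
    exact mul_div_cancel₀ _ (he i).ne'
  rw [← hrec hd' a', ← h3, ← hU, mulVec_mulVec, mul_assoc, h1', mul_one, ← mulVec_mulVec, hrec hd]

end Classification

/-- for pairs of nondegenerate Gaussian measures `μ = (μ₁,μ₂)`,
`ν = (ν₁,ν₂)` on `ℝ^N`, `m_μ = m_ν` holds if and only if some invertible affine map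
`T(x) = A x + b` pushes `μⱼ` forward to `νⱼ` for `j = 1, 2`. -/
theorem gaussian_pair_same_class_iff_affine
    {N : ℕ} (hN : 1 ≤ N)
    (m₁ m₂ n₁ n₂ : Fin N → ℝ) (S₁ S₂ T₁ T₂ : Matrix (Fin N) (Fin N) ℝ)
    (hS₁ : S₁.PosDef) (hS₂ : S₂.PosDef) (hT₁ : T₁.PosDef) (hT₂ : T₂.PosDef) :
    mPair (gaussianMeasure m₁ S₁) (gaussianMeasure m₂ S₂)
        = mPair (gaussianMeasure n₁ T₁) (gaussianMeasure n₂ T₂) ↔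
      ∃ (A : Matrix (Fin N) (Fin N) ℝ) (b : Fin N → ℝ), IsUnit A.det ∧
        (gaussianMeasure m₁ S₁).map (fun x => A *ᵥ x + b) = gaussianMeasure n₁ T₁ ∧
        (gaussianMeasure m₂ S₂).map (fun x => A *ᵥ x + b) = gaussianMeasure n₂ T₂ := by
  constructor
  · intro h
    obtain ⟨A, d, hA, hd, hA₁, hA₂⟩ := exists_simultaneous_diagonalization hS₁ hS₂
    obtain ⟨B, e, hB, he, hB₁, hB₂⟩ := exists_simultaneous_diagonalization hT₁ hT₂
    have hm := mPair_gaussianMeasure_map_affine hA hS₁ hS₂ m₁ m₂ (-(A *ᵥ m₁))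
    have hn := mPair_gaussianMeasure_map_affine hB hT₁ hT₂ n₁ n₂ (-(B *ᵥ n₁))
    rw [gaussianMeasure_map_affine hA hS₁, gaussianMeasure_map_affine hA hS₂, hA₁, hA₂,
      add_neg_cancel] at hm
    rw [gaussianMeasure_map_affine hB hT₁, gaussianMeasure_map_affine hB hT₂, hB₁, hB₂,
      add_neg_cancel] at hn
    obtain ⟨U, hUU, hUd, hUa⟩ := exists_orthogonal_of_mPair_eq hd he (hm.trans (h.trans hn.symm))
    have hUdet : IsUnit U.det := (isUnit_iff_isUnit_det _).1 (IsUnit.of_mul_eq_one _ hUU)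
    have hM : IsUnit (B⁻¹ * U * A).det := by
      rw [det_mul, det_mul]
      exact ((isUnit_nonsing_inv_det _ hB).mul hUdet).mul hA
    have hcov {S T D E : Matrix (Fin N) (Fin N) ℝ} (hS : A * S * Aᵀ = D) (hT : B * T * Bᵀ = E)
        (hDE : U * D * Uᵀ = E) : (B⁻¹ * U * A) * S * (B⁻¹ * U * A)ᵀ = T := by
      have hBt : IsUnit Bᵀ.det := by rwa [det_transpose]
      rw [transpose_mul, transpose_mul, transpose_nonsing_inv,
        show (B⁻¹ * U * A) * S * (Aᵀ * (Uᵀ * Bᵀ⁻¹)) = B⁻¹ * (U * (A * S * Aᵀ) * Uᵀ) * Bᵀ⁻¹ by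
          simp only [mul_assoc], hS, hDE, ← hT,
        show B⁻¹ * (B * T * Bᵀ) * Bᵀ⁻¹ = (B⁻¹ * B) * T * (Bᵀ * Bᵀ⁻¹) by simp only [mul_assoc],
        nonsing_inv_mul _ hB, mul_nonsing_inv _ hBt, one_mul, mul_one]
    refine ⟨B⁻¹ * U * A, n₁ - (B⁻¹ * U * A) *ᵥ m₁, hM, ?_, ?_⟩
    · rw [gaussianMeasure_map_affine hM hS₁, hcov hA₁ hB₁ (by rw [mul_one, hUU]),
        add_sub_cancel]
    · rw [gaussianMeasure_map_affine hM hS₂, hcov hA₂ hB₂ hUd]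
      congr 1
      have : (B⁻¹ * U * A) *ᵥ m₂ - (B⁻¹ * U * A) *ᵥ m₁ = n₂ - n₁ := by
        rw [← mulVec_sub, mul_assoc, ← mulVec_mulVec, ← mulVec_mulVec, mulVec_sub,
          sub_eq_add_neg (A *ᵥ m₂), hUa, ← sub_eq_add_neg, ← mulVec_sub, mulVec_mulVec,
          nonsing_inv_mul _ hB, one_mulVec]
      rw [add_sub_left_comm, this, add_sub_cancel]
  · rintro ⟨A, b, hA, h₁, h₂⟩
    rw [← h₁, ← h₂, mPair_gaussianMeasure_map_affine hA hS₁ hS₂]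

end
end
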